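/- arXiv:math/0608546 — 6 statements merged into one kernel-verified Lean document; each statement's English description precedes it below -/
import Mathlib

section
/- Let 0 < k < n be integers and let λ and μ be partitions fitting in the k×(n−k) rectangle such that λ and the 180°-rotation of μ do not overlap, i.e. λ_i + μ_{k+1−i} ≤ n−k for all 1 ≤ i ≤ k. Then there exists a partition ν fitting in the k×(n−k) rectangle, with |ν| = |λ| + |μ|, such that the Littlewood–Richardson number c_{λμ}^{ν} is equal to 1. -/
/-- The conjugate (transpose) of a partition, 0-indexed:
`conj p j = #{i | p i > j}`, i.e. `conj p (j-1) = p'_j` in 1-indexed notation. -/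
noncomputable def conj (p : ℕ → ℕ) (j : ℕ) : ℕ := Set.ncard {i : ℕ | j < p i}

/-- `p` is a partition (0-indexed parts, so `p i` is the `(i+1)`-st part)
fitting in the `k × r` rectangle: at most `k` nonzero parts, each of size at most `r`. -/
def IsRectPartition (k r : ℕ) (p : ℕ → ℕ) : Prop :=
  (∀ i, p (i + 1) ≤ p i) ∧ (∀ i, k ≤ i → p i = 0) ∧ (∀ i, p i ≤ r)

/-- The box in row `i`, column `j` (both 0-indexed) lies in the skew shape `nu/lam`. -/
def InSkew (lam nu : ℕ → ℕ) (i j : ℕ) : Prop := lam i ≤ j ∧ j < nu i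

/-- A Littlewood–Richardson filling of the skew shape `nu/lam` of content `mu`:
a filling with positive integers (recorded as a function `T` that is `0` outside
the shape), weakly increasing along rows (left to right), strictly increasing
down columns, whose reading word (entries read right to left along each row, rows
taken top to bottom) is Yamanouchi -- every prefix of the word contains, for each
`e ≥ 1`, at least as many occurrences of `e` as of `e+1`; a prefix of the reading
word consists of the boxes `(i,j)` with `i < m`, or `i = m` and `j ≥ c` --
and whose entries have content `mu`: the value `e+1` occurs exactly `mu e` times
(0-indexed, i.e. the value `i` occurs `μ_i` times). -/
def IsLRFilling (lam mu nu : ℕ → ℕ) (T : ℕ → ℕ → ℕ) : Prop :=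
  (∀ i j, ¬ InSkew lam nu i j → T i j = 0) ∧
  (∀ i j, InSkew lam nu i j → 1 ≤ T i j) ∧
  (∀ i j1 j2, InSkew lam nu i j1 → InSkew lam nu i j2 → j1 ≤ j2 → T i j1 ≤ T i j2) ∧
  (∀ i1 i2 j, i1 < i2 → InSkew lam nu i1 j → InSkew lam nu i2 j → T i1 j < T i2 j) ∧
  (∀ m c e, 1 ≤ e →
    Set.ncard {p : ℕ × ℕ | InSkew lam nu p.1 p.2 ∧
        (p.1 < m ∨ (p.1 = m ∧ c ≤ p.2)) ∧ T p.1 p.2 = e + 1} ≤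
      Set.ncard {p : ℕ × ℕ | InSkew lam nu p.1 p.2 ∧
        (p.1 < m ∨ (p.1 = m ∧ c ≤ p.2)) ∧ T p.1 p.2 = e}) ∧
  (∀ e, Set.ncard {p : ℕ × ℕ | InSkew lam nu p.1 p.2 ∧ T p.1 p.2 = e + 1} = mu e)

/-- The Littlewood–Richardson number `c_{λμ}^{ν}`: the number of
Littlewood–Richardson fillings of `ν/λ` of content `μ`. -/
noncomputable def lrCoeff (lam mu nu : ℕ → ℕ) : ℕ :=
  Set.ncard {T : ℕ → ℕ → ℕ | IsLRFilling lam mu nu T}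


open Finset in
/-- columns of the boxes of row `i` with entry `v` -/
def rowF (lam nu : ℕ → ℕ) (T : ℕ → ℕ → ℕ) (i v : ℕ) : Finset ℕ :=
  (Finset.Ico (lam i) (nu i)).filter (fun j => T i j = v)

/-- number of entries `v` in the first `m` rows -/
def cntF (lam nu : ℕ → ℕ) (T : ℕ → ℕ → ℕ) (m v : ℕ) : ℕ :=
  ∑ i ∈ Finset.range m, (rowF lam nu T i v).card

lemma mem_rowF (lam nu : ℕ → ℕ) (T : ℕ → ℕ → ℕ) (i v j : ℕ) :
    j ∈ rowF lam nu T i v ↔ InSkew lam nu i j ∧ T i j = v := by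
  simp [rowF, InSkew]

lemma ncard_initial (lam nu : ℕ → ℕ) (T : ℕ → ℕ → ℕ) (m c v : ℕ) :
    Set.ncard {p : ℕ × ℕ | InSkew lam nu p.1 p.2 ∧
        (p.1 < m ∨ (p.1 = m ∧ c ≤ p.2)) ∧ T p.1 p.2 = v} =
      cntF lam nu T m v + ((rowF lam nu T m v).filter (fun j => c ≤ j)).card := by
  classical
  have h : {p : ℕ × ℕ | InSkew lam nu p.1 p.2 ∧
        (p.1 < m ∨ (p.1 = m ∧ c ≤ p.2)) ∧ T p.1 p.2 = v} =
      (((Finset.range (m+1)).sigma (fun i => (rowF lam nu T i v).filter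
        (fun j => i < m ∨ c ≤ j))).map (Equiv.sigmaEquivProd ℕ ℕ).toEmbedding :
        Finset (ℕ × ℕ)) := by
    ext ⟨a, b⟩
    simp only [Set.mem_ofPred_eq, Finset.coe_map, Set.mem_image, Finset.mem_coe, Finset.mem_sigma,
      Finset.mem_range, Finset.mem_filter, mem_rowF]
    constructor
    · rintro ⟨h1, h2, h3⟩
      exact ⟨⟨a, b⟩, ⟨by simp only; omega, ⟨h1, h3⟩, by simp only; omega⟩, rfl⟩
    · rintro ⟨⟨a', b'⟩, ⟨h0, ⟨h1, h3⟩, h2⟩, h⟩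
      simp [Equiv.sigmaEquivProd] at h
      obtain ⟨rfl, rfl⟩ := h
      simp only at *
      exact ⟨h1, by omega, h3⟩
  rw [h, Set.ncard_coe_finset, Finset.card_map, Finset.card_sigma, Finset.sum_range_succ, cntF]
  congr 1
  · apply Finset.sum_congr rfl
    intro i hi
    have := Finset.mem_range.1 hi
    rw [Finset.filter_true_of_mem]
    intro j _; exact Or.inl this
  · congr 1
    ext j; simp

lemma ncard_total (k : ℕ) (lam nu : ℕ → ℕ) (T : ℕ → ℕ → ℕ) (hnu : ∀ i, k ≤ i → nu i = 0) (v : ℕ) :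
    Set.ncard {p : ℕ × ℕ | InSkew lam nu p.1 p.2 ∧ T p.1 p.2 = v} = cntF lam nu T k v := by
  have h := ncard_initial lam nu T k 0 v
  have h2 : rowF lam nu T k v = ∅ := by
    simp [rowF, hnu k le_rfl]
  rw [h2] at h
  simp only [Finset.filter_empty, Finset.card_empty, add_zero] at h
  rw [← h]
  congr 1
  ext ⟨a, b⟩
  simp only [Set.mem_ofPred_eq]
  constructor
  · rintro ⟨h1, h2⟩
    refine ⟨h1, ?_, h2⟩
    by_contra hc
    have := hnu a (by omega)
    have := h1.2
    omega
  · rintro ⟨h1, _, h2⟩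
    exact ⟨h1, h2⟩

lemma cntF_mono (lam nu : ℕ → ℕ) (T : ℕ → ℕ → ℕ) (v : ℕ) : Monotone (fun m => cntF lam nu T m v) := by
  apply monotone_nat_of_le_succ
  intro m
  simp [cntF, Finset.sum_range_succ]

section uniq
variable {k r : ℕ} {lam mu nu : ℕ → ℕ} {T : ℕ → ℕ → ℕ}

lemma cnt_le_total (hnu : ∀ i, k ≤ i → nu i = 0) (h : IsLRFilling lam mu nu T) (m e : ℕ) :
    cntF lam nu T m (e+1) ≤ mu e := by
  obtain ⟨_, _, _, _, _, h6⟩ := h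
  rw [← h6 e, ncard_total (max k m) lam nu T (fun i hi => hnu i (by omega))]
  exact cntF_mono lam nu T (e+1) (le_max_right k m)

lemma cnt_step (h : IsLRFilling lam mu nu T) (m e : ℕ) :
    cntF lam nu T (m+1) (e+2) ≤ cntF lam nu T m (e+1) := by
  obtain ⟨_, _, h3, _, h5, _⟩ := h
  obtain ⟨c, hc1, hc2⟩ : ∃ c, (∀ j ∈ rowF lam nu T m (e+2), c ≤ j) ∧
      (∀ j ∈ rowF lam nu T m (e+1), ¬ c ≤ j) := by
    by_cases hne : (rowF lam nu T m (e+2)).Nonempty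
    · refine ⟨(rowF lam nu T m (e+2)).min' hne, fun j hj => Finset.min'_le _ _ hj, ?_⟩
      intro j hj hle
      have h1 := Finset.min'_mem _ hne
      rw [mem_rowF] at h1 hj
      have := h3 m _ j h1.1 hj.1 hle
      omega
    · rw [Finset.not_nonempty_iff_eq_empty] at hne
      refine ⟨nu m, by simp [hne], ?_⟩
      intro j hj
      rw [mem_rowF] at hj
      have := hj.1.2
      omega
  have := h5 m c (e+1) (by omega)
  rw [ncard_initial, ncard_initial, Finset.filter_true_of_mem hc1,
    Finset.filter_false_of_mem hc2] at this
  simpa [cntF, Finset.sum_range_succ] using this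

lemma cnt_le_first (h : IsLRFilling lam mu nu T) (e : ℕ) : ∀ m,
    cntF lam nu T m (e+1) ≤ cntF lam nu T (m-e) 1 := by
  induction e with
  | zero => intro m; simp
  | succ e ih =>
    intro m
    cases m with
    | zero => simp [cntF]
    | succ m =>
      have h1 := cnt_step h m e
      have h2 := ih m
      have : m + 1 - (e+1) = m - e := by omega
      rw [this]
      exact h1.trans h2

lemma cnt_first_le (hlam : Antitone lam) (hr : ∀ i, nu i ≤ r) (h : IsLRFilling lam mu nu T) (t : ℕ) :
    cntF lam nu T (t+1) 1 ≤ r - lam t := by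
  obtain ⟨_, _, _, h4, _, _⟩ := h
  rw [cntF, ← Finset.card_biUnion, ← Nat.card_Ico]
  · apply Finset.card_le_card
    intro j hj
    simp only [Finset.mem_biUnion, Finset.mem_range, mem_rowF] at hj
    obtain ⟨i, hi, ⟨h1, h2⟩, _⟩ := hj
    have := hlam (show i ≤ t by omega)
    have := hr i
    simp only [Finset.mem_Ico]; omega
  · intro a _ b _ hab
    rw [Function.onFun, Finset.disjoint_left]
    intro j h1 h2
    rw [mem_rowF] at h1 h2
    rcases lt_or_gt_of_ne hab with hlt | hlt
    · have := h4 _ _ j hlt h1.1 h2.1; omega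
    · have := h4 _ _ j hlt h2.1 h1.1; omega

lemma entry_le (hmu : ∀ i, k ≤ i → mu i = 0) (hnu : ∀ i, k ≤ i → nu i = 0)
    (h : IsLRFilling lam mu nu T) (i j : ℕ) (hs : InSkew lam nu i j) : T i j ≤ k := by
  by_contra hc
  have h1 := cnt_le_total hnu h (i+1) (T i j - 1)
  rw [hmu _ (by omega)] at h1
  have : j ∈ rowF lam nu T i (T i j - 1 + 1) := by
    rw [mem_rowF]; exact ⟨hs, by omega⟩
  have := Finset.card_pos.2 ⟨j, this⟩
  simp only [cntF, Finset.sum_range_succ] at h1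
  omega

lemma row_sum (hmu : ∀ i, k ≤ i → mu i = 0) (hnu : ∀ i, k ≤ i → nu i = 0)
    (h : IsLRFilling lam mu nu T) (i : ℕ) :
    ∑ e ∈ Finset.range k, (rowF lam nu T i (e+1)).card = nu i - lam i := by
  rw [← Finset.card_biUnion, ← Nat.card_Ico]
  · congr 1
    ext j
    simp only [Finset.mem_biUnion, Finset.mem_range, mem_rowF, Finset.mem_Ico]
    constructor
    · rintro ⟨e, _, h1, _⟩; exact h1
    · intro hs
      have h1 := entry_le hmu hnu h i j hs
      have h2 := h.2.1 i j hs
      exact ⟨T i j - 1, by omega, hs, by omega⟩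
  · intro a _ b _ hab
    rw [Function.onFun, Finset.disjoint_left]
    intro j h1 h2
    rw [mem_rowF] at h1 h2
    omega

lemma cnt_sum (hmu : ∀ i, k ≤ i → mu i = 0) (hnu : ∀ i, k ≤ i → nu i = 0)
    (h : IsLRFilling lam mu nu T) (m : ℕ) :
    ∑ e ∈ Finset.range k, cntF lam nu T m (e+1) = ∑ i ∈ Finset.range m, (nu i - lam i) := by
  unfold cntF
  rw [Finset.sum_comm]
  exact Finset.sum_congr rfl fun i _ => row_sum hmu hnu h i

/-- entries at most `e` are an initial segment of the row, of the right length -/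
lemma entry_iff (h : IsLRFilling lam mu nu T) (i j e : ℕ) (hs : InSkew lam nu i j) :
    T i j ≤ e ↔ j < lam i + ∑ s ∈ Finset.range e, (rowF lam nu T i (s+1)).card := by
  have hc : ∑ s ∈ Finset.range e, (rowF lam nu T i (s+1)).card =
      ((Finset.Ico (lam i) (nu i)).filter (fun j => T i j ≤ e)).card := by
    rw [← Finset.card_biUnion]
    · congr 1
      ext j
      simp only [Finset.mem_biUnion, Finset.mem_range, mem_rowF, Finset.mem_Ico, Finset.mem_filter]
      constructor
      · rintro ⟨e, _, h1, _⟩; exact ⟨h1, by omega⟩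
      · rintro ⟨hs, hle⟩
        have h2 := h.2.1 i j hs
        exact ⟨T i j - 1, by omega, hs, by omega⟩
    · intro a _ b _ hab
      rw [Function.onFun, Finset.disjoint_left]
      intro j h1 h2
      rw [mem_rowF] at h1 h2
      omega
  rw [hc]
  have h3 := h.2.2.1 i
  constructor
  · intro hle
    have : Finset.Ico (lam i) (j+1) ⊆ (Finset.Ico (lam i) (nu i)).filter (fun j => T i j ≤ e) := by
      intro j' hj'
      rw [Finset.mem_Ico] at hj'
      have hs' : InSkew lam nu i j' := ⟨hj'.1, by have := hs.2; omega⟩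
      have := h3 j' j hs' hs (by omega)
      rw [Finset.mem_filter, Finset.mem_Ico]
      exact ⟨hs', by omega⟩
    have := Finset.card_le_card this
    rw [Nat.card_Ico] at this
    have := hs.1
    omega
  · intro hlt
    by_contra hc
    have : (Finset.Ico (lam i) (nu i)).filter (fun j => T i j ≤ e) ⊆ Finset.Ico (lam i) j := by
      intro j' hj'
      rw [Finset.mem_filter, Finset.mem_Ico] at hj'
      rw [Finset.mem_Ico]
      refine ⟨hj'.1.1, ?_⟩
      by_contra hge
      have := h3 j j' hs hj'.1 (by omega)
      omega
    have := Finset.card_le_card this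
    rw [Nat.card_Ico] at this
    have := hs.1
    omega

lemma eq_of_cnt {T' : ℕ → ℕ → ℕ} (h : IsLRFilling lam mu nu T) (h' : IsLRFilling lam mu nu T')
    (hc : ∀ m e, cntF lam nu T m (e+1) = cntF lam nu T' m (e+1)) : T = T' := by
  have hrow : ∀ i e, (rowF lam nu T i (e+1)).card = (rowF lam nu T' i (e+1)).card := by
    intro i e
    have h1 := hc i e
    have h2 := hc (i+1) e
    simp only [cntF, Finset.sum_range_succ] at h1 h2
    omega
  funext i j
  by_cases hs : InSkew lam nu i j
  · have key : ∀ e, T i j ≤ e ↔ T' i j ≤ e := by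
      intro e
      rw [entry_iff h i j e hs, entry_iff h' i j e hs]
      simp [hrow]
    exact le_antisymm ((key _).2 le_rfl) ((key _).1 le_rfl)
  · rw [h.1 i j hs, h'.1 i j hs]

end uniq

/-- column bound -/
def BB (r : ℕ) (lam : ℕ → ℕ) : ℕ → ℕ
  | 0 => 0
  | t+1 => r - lam t

/-- number of letters `e+1` in the first `i` rows of the extremal filling -/
def NN (r : ℕ) (lam mu : ℕ → ℕ) (i e : ℕ) : ℕ := min (mu e) (BB r lam (i - e))

/-- shape of the letters at most `e` in the extremal filling -/
def LL (r : ℕ) (lam mu : ℕ → ℕ) (i e : ℕ) : ℕ :=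
  lam i + ∑ s ∈ Finset.range e, (NN r lam mu (i+1) s - NN r lam mu i s)

open Classical in
/-- the extremal filling -/
noncomputable def TT (k r : ℕ) (lam mu : ℕ → ℕ) (i j : ℕ) : ℕ :=
  if InSkew lam (fun i => LL r lam mu i k) i j then sInf {e | j < LL r lam mu i e} else 0

section exist
variable {k r : ℕ} {lam mu : ℕ → ℕ}

lemma BB_mono (hlam : Antitone lam) : Monotone (BB r lam) := by
  apply monotone_nat_of_le_succ
  intro t
  cases t with
  | zero => simp [BB]
  | succ t =>
    have := hlam (show t ≤ t + 1 by omega)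
    simp only [BB]
    omega

lemma NN_mono (hlam : Antitone lam) (e : ℕ) {i i' : ℕ} (h : i ≤ i') :
    NN r lam mu i e ≤ NN r lam mu i' e := by
  have := BB_mono (r := r) hlam (show i - e ≤ i' - e by omega)
  unfold NN; omega

lemma LL_zero (i : ℕ) : LL r lam mu i 0 = lam i := by simp [LL]

lemma LL_succ (i e : ℕ) :
    LL r lam mu i (e+1) = LL r lam mu i e + (NN r lam mu (i+1) e - NN r lam mu i e) := by
  simp [LL, Finset.sum_range_succ]; omega

lemma LL_mono (i : ℕ) : Monotone (LL r lam mu i) :=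
  monotone_nat_of_le_succ fun e => by rw [LL_succ]; omega

lemma LL_step (hlam : Antitone lam) (hmu : Antitone mu) (hr : ∀ i, lam i ≤ r) (i e : ℕ) :
    LL r lam mu (i+1) (e+1) ≤ LL r lam mu i e := by
  induction e with
  | zero =>
    rw [LL_succ, LL_zero, LL_zero]
    simp only [NN, BB, Nat.sub_zero]
    have := hlam (Nat.le_succ i)
    have := hr i
    have := hr (i+1)
    simp only [Nat.succ_eq_add_one] at *
    omega
  | succ e ih =>
    rw [LL_succ (i+1) (e+1), LL_succ i e]
    have h1 := NN_mono (r := r) (mu := mu) hlam e (Nat.le_succ i)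
    simp only [NN] at h1 ⊢
    have e1 : i + 1 + 1 - (e+1) = i + 1 - e := by omega
    have e2 : i + 1 - (e+1) = i - e := by omega
    rw [e1, e2]
    have := BB_mono (r := r) hlam (show i - e ≤ i + 1 - e by omega)
    have := hmu (Nat.le_succ e)
    simp only [Nat.succ_eq_add_one] at *
    omega

lemma LL_anti (hlam : Antitone lam) (hmu : Antitone mu) (hr : ∀ i, lam i ≤ r) (e : ℕ) :
    Antitone (fun i => LL r lam mu i e) :=
  antitone_nat_of_succ_le fun i => (LL_mono (i+1) (Nat.le_succ e)).trans (LL_step hlam hmu hr i e)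

lemma LL_le_k (hmu : ∀ i, k ≤ i → mu i = 0) (i e : ℕ) : LL r lam mu i e ≤ LL r lam mu i k := by
  by_cases h : e ≤ k
  · exact LL_mono i h
  · obtain ⟨d, rfl⟩ := Nat.exists_eq_add_of_le (show k ≤ e by omega)
    clear h
    induction d with
    | zero => simp
    | succ d ih =>
      rw [← add_assoc, LL_succ]
      simp only [NN, hmu (k+d) (by omega)]
      omega

lemma NN_full (hlam : Antitone lam) (hmu0 : ∀ i, k ≤ i → mu i = 0)
    (hno : ∀ i, i < k → lam i + mu (k - 1 - i) ≤ r) {i : ℕ} (hi : k ≤ i) (e : ℕ) :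
    NN r lam mu i e = mu e := by
  by_cases he : e < k
  · have h1 := hno (k - 1 - e) (by omega)
    have h2 : k - 1 - (k - 1 - e) = e := by omega
    rw [h2] at h1
    have h3 := BB_mono (r := r) hlam (show (k - 1 - e) + 1 ≤ i - e by omega)
    rw [show BB r lam (k - 1 - e + 1) = r - lam (k - 1 - e) from rfl] at h3
    unfold NN
    omega
  · simp [NN, hmu0 e (by omega)]

lemma sum_sub_NN (hlam : Antitone lam) (m e : ℕ) :
    ∑ i ∈ Finset.range m, (NN r lam mu (i+1) e - NN r lam mu i e) = NN r lam mu m e := by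
  induction m with
  | zero => simp [NN, BB]
  | succ m ih =>
    rw [Finset.sum_range_succ, ih]
    have := NN_mono (r := r) (mu := mu) hlam e (Nat.le_succ m)
    simp only [Nat.succ_eq_add_one] at *
    omega

lemma TT_le_iff (i j e : ℕ) (hs : InSkew lam (fun i => LL r lam mu i k) i j) :
    TT k r lam mu i j ≤ e ↔ j < LL r lam mu i e := by
  rw [TT, if_pos hs]
  have hne : {e | j < LL r lam mu i e}.Nonempty := ⟨k, hs.2⟩
  constructor
  · intro h
    have hm : j < LL r lam mu i (sInf {e | j < LL r lam mu i e}) := Nat.sInf_mem hne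
    exact lt_of_lt_of_le hm (LL_mono i h)
  · intro h
    exact Nat.sInf_le h

lemma TT_pos (i j : ℕ) (hs : InSkew lam (fun i => LL r lam mu i k) i j) :
    1 ≤ TT k r lam mu i j := by
  by_contra hc
  have := (TT_le_iff i j 0 hs).1 (by omega)
  rw [LL_zero] at this
  have := hs.1
  omega

lemma TT_cnt (hlam : Antitone lam) (hmu0 : ∀ i, k ≤ i → mu i = 0) (m e : ℕ) :
    cntF lam (fun i => LL r lam mu i k) (TT k r lam mu) m (e+1) = NN r lam mu m e := by
  rw [← sum_sub_NN hlam, cntF]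
  apply Finset.sum_congr rfl
  intro i _
  have : rowF lam (fun i => LL r lam mu i k) (TT k r lam mu) i (e+1) =
      Finset.Ico (LL r lam mu i e) (LL r lam mu i (e+1)) := by
    ext j
    rw [mem_rowF, Finset.mem_Ico]
    constructor
    · rintro ⟨hs, h⟩
      have h1 := TT_le_iff i j e hs
      have h2 := TT_le_iff i j (e+1) hs
      omega
    · rintro ⟨ha, hb⟩
      have hs : InSkew lam (fun i => LL r lam mu i k) i j :=
        ⟨by have := LL_mono (r := r) (lam := lam) (mu := mu) i (Nat.zero_le e)
            rw [LL_zero] at this; omega,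
          lt_of_lt_of_le hb (LL_le_k hmu0 i (e+1))⟩
      have h1 := TT_le_iff i j e hs
      have h2 := TT_le_iff i j (e+1) hs
      exact ⟨hs, by omega⟩
  rw [this, Nat.card_Ico, LL_succ]
  omega

lemma NN_step (hmu : Antitone mu) (m e : ℕ) : NN r lam mu (m+1) (e+1) ≤ NN r lam mu m e := by
  have := hmu (Nat.le_succ e)
  have e2 : m + 1 - (e+1) = m - e := by omega
  simp only [NN, e2, Nat.succ_eq_add_one] at *
  omega

lemma nu_zero (hlam : Antitone lam) (hlam0 : ∀ i, k ≤ i → lam i = 0) (hmu0 : ∀ i, k ≤ i → mu i = 0)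
    (hno : ∀ i, i < k → lam i + mu (k - 1 - i) ≤ r) (i : ℕ) (hi : k ≤ i) : LL r lam mu i k = 0 := by
  unfold LL
  rw [hlam0 i hi]
  simp [NN_full hlam hmu0 hno hi, NN_full hlam hmu0 hno (show k ≤ i + 1 by omega)]

lemma TT_isLR (hlam : Antitone lam) (hmu : Antitone mu) (hr : ∀ i, lam i ≤ r)
    (hlam0 : ∀ i, k ≤ i → lam i = 0) (hmu0 : ∀ i, k ≤ i → mu i = 0)
    (hno : ∀ i, i < k → lam i + mu (k - 1 - i) ≤ r) :
    IsLRFilling lam mu (fun i => LL r lam mu i k) (TT k r lam mu) := by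
  refine ⟨?_, TT_pos, ?_, ?_, ?_, ?_⟩
  · intro i j hs
    rw [TT, if_neg hs]
  · intro i j1 j2 h1 h2 hle
    rw [TT_le_iff i j1 _ h1]
    exact lt_of_le_of_lt hle ((TT_le_iff i j2 _ h2).1 le_rfl)
  · intro i1 i2 j hlt h1 h2
    have hp := TT_pos i2 j h2
    obtain ⟨e, he⟩ : ∃ e, TT k r lam mu i2 j = e + 1 := ⟨_, (Nat.sub_add_cancel hp).symm⟩
    have ha := (TT_le_iff i2 j (e+1) h2).1 he.le
    have hb := LL_anti hlam hmu hr (e+1) (show i1 + 1 ≤ i2 by omega)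
    have hc := LL_step hlam hmu hr i1 e
    have hd := (TT_le_iff i1 j e h1).2 (by simp only at hb; omega)
    omega
  · intro m c e he
    obtain ⟨e, rfl⟩ : ∃ e', e = e' + 1 := ⟨e - 1, by omega⟩
    rw [ncard_initial, ncard_initial]
    have h1 := NN_step (r := r) (lam := lam) hmu m e
    rw [← TT_cnt (k := k) hlam hmu0, ← TT_cnt (k := k) hlam hmu0] at h1
    have h2 := Finset.card_filter_le
      (rowF lam (fun i => LL r lam mu i k) (TT k r lam mu) m (e+1+1)) (fun j => c ≤ j)
    have h3 : cntF lam (fun i => LL r lam mu i k) (TT k r lam mu) (m+1) (e+1+1) =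
        cntF lam (fun i => LL r lam mu i k) (TT k r lam mu) m (e+1+1) +
        (rowF lam (fun i => LL r lam mu i k) (TT k r lam mu) m (e+1+1)).card := by
      simp [cntF, Finset.sum_range_succ]
    omega
  · intro e
    rw [ncard_total k _ _ _ (nu_zero hlam hlam0 hmu0 hno), TT_cnt hlam hmu0,
      NN_full hlam hmu0 hno le_rfl]

end exist

/-- If `λ` and `μ` fit in the `k × (n−k)` rectangle and `λ` does not
overlap the 180°-rotation of `μ` (i.e. `λ_i + μ_{k+1−i} ≤ n−k` for `1 ≤ i ≤ k`), then
there is a partition `ν` in the rectangle with `|ν| = |λ| + |μ|` and `c_{λμ}^{ν} = 1`. -/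
theorem exists_nu_lrCoeff_eq_one (n k : ℕ) (hk : 0 < k) (hkn : k < n)
    (lam mu : ℕ → ℕ)
    (hlam : IsRectPartition k (n - k) lam) (hmu : IsRectPartition k (n - k) mu)
    (hno : ∀ i, i < k → lam i + mu (k - 1 - i) ≤ n - k) :
    ∃ nu : ℕ → ℕ, IsRectPartition k (n - k) nu ∧
      (∑ i ∈ Finset.range k, nu i) =
        (∑ i ∈ Finset.range k, lam i) + (∑ i ∈ Finset.range k, mu i) ∧
      lrCoeff lam mu nu = 1 := by
  obtain ⟨hl1, hlam0, hlr⟩ := hlam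
  obtain ⟨hm1, hmu0, hmr⟩ := hmu
  have hl : Antitone lam := antitone_nat_of_succ_le hl1
  have hm : Antitone mu := antitone_nat_of_succ_le hm1
  generalize n - k = r at *
  have hnu0 := nu_zero hl hlam0 hmu0 hno
  have hT := TT_isLR hl hm hlr hlam0 hmu0 hno
  have hanti := LL_anti hl hm hlr k
  have hnur : ∀ i, LL r lam mu i k ≤ r := by
    intro i
    refine (hanti (Nat.zero_le i)).trans ?_
    obtain ⟨k', rfl⟩ : ∃ k', k = k' + 1 := ⟨k - 1, by omega⟩
    have h0 : LL r lam mu 0 (k'+1) = lam 0 + NN r lam mu 1 0 := by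
      unfold LL
      rw [Finset.sum_range_succ']
      simp [NN, BB]
    simp only [h0]
    have := hlr 0
    simp only [NN, BB, Nat.sub_zero]
    omega
  refine ⟨fun i => LL r lam mu i k, ⟨fun i => hanti (Nat.le_succ i), hnu0, hnur⟩, ?_, ?_⟩
  · simp only [LL]
    rw [Finset.sum_add_distrib, Finset.sum_comm]
    congr 1
    apply Finset.sum_congr rfl
    intro e _
    rw [sum_sub_NN hl, NN_full hl hmu0 hno le_rfl]
  · rw [lrCoeff, Set.ncard_eq_one]
    refine ⟨TT k r lam mu, ?_⟩
    ext T
    simp only [Set.mem_ofPred_eq, Set.mem_singleton_iff]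
    constructor
    swap
    · rintro rfl; exact hT
    intro h
    have hle : ∀ m e, cntF lam (fun i => LL r lam mu i k) T m (e+1) ≤ NN r lam mu m e := by
      intro m e
      refine le_min (cnt_le_total hnu0 h m e) ((cnt_le_first h e m).trans ?_)
      cases m - e with
      | zero => simp [cntF]
      | succ t => exact cnt_first_le hl hnur h t
    apply eq_of_cnt h hT
    intro m e
    by_cases he : e < k
    · have hs := (cnt_sum hmu0 hnu0 h m).trans (cnt_sum hmu0 hnu0 hT m).symm
      refine (Finset.sum_eq_sum_iff_of_le ?_).1 hs e (Finset.mem_range.2 he)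
      intro e _
      rw [TT_cnt hl hmu0]
      exact hle m e
    · have h1 := cnt_le_total hnu0 h m e
      have h2 := cnt_le_total hnu0 hT m e
      have := hmu0 e (by omega)
      omega
end

section
/- Let 0 < k < n be integers and let λ and μ be partitions fitting in the k×(n−k) rectangle such that λ_i + μ_{k+1−i} ≤ n−k for all 1 ≤ i ≤ k. Let ρ = ρ(λ,μ) be the partition obtained by sorting the numbers k − λ'_j − μ'_{n−k+1−j} (for j = 1, …, n−k) into weakly decreasing order, and set ν(λ,μ) = (ρ')^∨, the complement of the conjugate of ρ in the k×(n−k) rectangle. Then ν(λ,μ) fits in the k×(n−k) rectangle, |ν(λ,μ)| = |λ| + |μ|, and c_{λμ}^{ν(λ,μ)} = 1. -/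
/-- `ρ(λ,μ)`: the numbers `k − λ'_j − μ'_{n−k+1−j}` for `j = 1, …, n−k`
(here expressed 0-indexed), sorted into weakly decreasing order. -/
noncomputable def rhoFun (n k : ℕ) (lam mu : ℕ → ℕ) : ℕ → ℕ := fun r =>
  (List.insertionSort (· ≥ ·)
    ((List.range (n - k)).map fun j => k - conj lam j - conj mu (n - k - 1 - j))).getD r 0

/-- `ν(λ,μ) = (ρ')^∨`, the complement in the `k × (n−k)` rectangle of the
conjugate of `ρ(λ,μ)`: its `i`-th part (1-indexed) is `(n−k) − ρ'_{k+1−i}`. -/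
noncomputable def nuFun (n k : ℕ) (lam mu : ℕ → ℕ) : ℕ → ℕ := fun i =>
  if i < k then (n - k) - conj (rhoFun n k lam mu) (k - 1 - i) else 0

open Finset in
lemma conj_iff_aux (p : ℕ → ℕ) (k : ℕ) (h1 : ∀ i, p (i + 1) ≤ p i) (h2 : ∀ i, k ≤ i → p i = 0)
    (i j : ℕ) : i < conj p j ↔ j < p i := by
  have hanti : Antitone p := antitone_nat_of_succ_le h1
  have hex : ∃ m, p m ≤ j := ⟨k, by rw [h2 k le_rfl]; exact Nat.zero_le _⟩
  classical
  have hset : {i : ℕ | j < p i} = ((Finset.range (Nat.find hex) : Finset ℕ) : Set ℕ) := by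
    ext x
    simp only [Set.mem_setOf_eq, Finset.coe_range, Set.mem_Iio]
    constructor
    · intro hx
      by_contra hc
      have := hanti (not_lt.mp hc)
      have := Nat.find_spec hex
      omega
    · intro hx
      have := Nat.find_min hex hx
      omega
  have hc : conj p j = Nat.find hex := by
    unfold conj
    rw [hset, Set.ncard_coe_finset, Finset.card_range]
  have := congrArg (fun s : Set ℕ => i ∈ s) hset
  simp only [Set.mem_setOf_eq, Finset.coe_range, Set.mem_Iio, eq_iff_iff] at this
  rw [hc, this]

lemma countP_sorted_aux (t : ℕ) (l : List ℕ) :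
    Set.ncard {q : ℕ | t < l.getD q 0} = l.countP (fun x => decide (t < x)) := by
  induction l with
  | nil => simp
  | cons a l ih =>
    have hfin : {q : ℕ | t < l.getD q 0}.Finite := by
      apply (Set.finite_Iio l.length).subset
      intro q hq
      by_contra hc
      simp only [Set.mem_Iio, not_lt] at hc
      simp only [Set.mem_setOf_eq, List.getD_eq_default _ _ hc] at hq
      omega
    have himg : (Nat.succ '' {q : ℕ | t < l.getD q 0}).ncard
        = {q : ℕ | t < l.getD q 0}.ncard :=
      Set.ncard_image_of_injective _ Nat.succ_injective
    rw [List.countP_cons, ← ih]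
    by_cases h : t < a
    · have : {q : ℕ | t < (a :: l).getD q 0}
          = insert 0 (Nat.succ '' {q : ℕ | t < l.getD q 0}) := by
        ext q
        cases q <;> simp [h]
      rw [this, Set.ncard_insert_of_notMem (by simp) (hfin.image _), himg]
      simp [h]
    · have : {q : ℕ | t < (a :: l).getD q 0}
          = (Nat.succ '' {q : ℕ | t < l.getD q 0}) := by
        ext q
        cases q <;> simp [h]
      rw [this, himg]
      simp [h]

lemma countP_range_aux (r : ℕ) (P : ℕ → Prop) [DecidablePred P] :
    (List.range r).countP (fun j => decide (P j)) = ((Finset.range r).filter P).card := by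
  induction r with
  | zero => simp
  | succ r ih =>
    rw [List.range_succ, List.countP_append, ih, Finset.range_add_one, Finset.filter_insert]
    by_cases h : P r <;> simp [h]

lemma conj_rho_aux (n k : ℕ) (lam mu : ℕ → ℕ) (t : ℕ) :
    conj (rhoFun n k lam mu) t = ((Finset.range (n - k)).filter
      (fun j => t < k - conj lam j - conj mu (n - k - 1 - j))).card := by
  unfold conj rhoFun
  rw [countP_sorted_aux, (List.perm_insertionSort _ _).countP_eq, List.countP_map,
    ← countP_range_aux]
  rfl

section core
open Finset
open scoped Classical

noncomputable def skD (k r : ℕ) (lam nu : ℕ → ℕ) : Finset (ℕ × ℕ) :=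
  (range k ×ˢ range r).filter (fun p => InSkew lam nu p.1 p.2)

noncomputable def skN (k r : ℕ) (lam nu : ℕ → ℕ) (T : ℕ → ℕ → ℕ) (m v : ℕ) : ℕ :=
  ((skD k r lam nu).filter (fun p => p.1 < m ∧ T p.1 p.2 = v)).card

noncomputable def skR (r : ℕ) (lam nu : ℕ → ℕ) (T : ℕ → ℕ → ℕ) (m v : ℕ) : ℕ :=
  ((range r).filter (fun j => InSkew lam nu m j ∧ T m j = v)).card

variable {k r : ℕ} {lam mu nu : ℕ → ℕ}

lemma mem_skD (hnuk : ∀ i, k ≤ i → nu i = 0) (hnur : ∀ i, nu i ≤ r) (p : ℕ × ℕ) :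
    p ∈ skD k r lam nu ↔ InSkew lam nu p.1 p.2 := by
  unfold skD
  simp only [mem_filter, mem_product, mem_range, and_iff_right_iff_imp]
  rintro ⟨h1, h2⟩
  constructor
  · by_contra hc
    have := hnuk p.1 (not_lt.mp hc)
    omega
  · have := hnur p.1
    omega

lemma ncard_skD (hnuk : ∀ i, k ≤ i → nu i = 0) (hnur : ∀ i, nu i ≤ r) (Q : ℕ × ℕ → Prop) :
    Set.ncard {p : ℕ × ℕ | InSkew lam nu p.1 p.2 ∧ Q p} = ((skD k r lam nu).filter Q).card := by
  rw [← Set.ncard_coe_finset]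
  congr 1
  ext p
  simp [mem_skD hnuk hnur]

lemma skN_succ (hnuk : ∀ i, k ≤ i → nu i = 0) (hnur : ∀ i, nu i ≤ r) (T : ℕ → ℕ → ℕ) (m v : ℕ) :
    skN k r lam nu T (m + 1) v = skN k r lam nu T m v + skR r lam nu T m v := by
  unfold skN skR
  have himg : (((range r).filter (fun j => InSkew lam nu m j ∧ T m j = v)).image
      (fun j => (m, j))).card = ((range r).filter (fun j => InSkew lam nu m j ∧ T m j = v)).card :=
    card_image_of_injective _ (fun a b h => by simpa using h)
  rw [← himg, ← card_union_of_disjoint]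
  · congr 1
    ext ⟨a, b⟩
    simp only [mem_filter, mem_skD hnuk hnur, mem_union, mem_image, mem_range, Prod.mk.injEq]
    constructor
    · rintro ⟨h1, h2, h3⟩
      by_cases h : a < m
      · exact Or.inl ⟨h1, h, h3⟩
      · have : a = m := by omega
        subst this
        refine Or.inr ⟨b, ⟨lt_of_lt_of_le h1.2 (hnur _), h1, h3⟩, rfl, rfl⟩
    · rintro (⟨h1, h2, h3⟩ | ⟨j, ⟨h1, h2, h3⟩, rfl, rfl⟩)
      · exact ⟨h1, by omega, h3⟩
      · exact ⟨h2, by omega, h3⟩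
  · rw [disjoint_left]
    rintro ⟨a, b⟩ h1 h2
    simp only [mem_filter, mem_image, Prod.mk.injEq] at h1 h2
    obtain ⟨j, _, rfl, rfl⟩ := h2
    exact lt_irrefl _ h1.2.1

lemma skN_zero (T : ℕ → ℕ → ℕ) (v : ℕ) : skN k r lam nu T 0 v = 0 := by
  unfold skN; simp

/-- Strong Yamanouchi inequality. -/
lemma skN_yam (hnuk : ∀ i, k ≤ i → nu i = 0) (hnur : ∀ i, nu i ≤ r) {T : ℕ → ℕ → ℕ}
    (hT : IsLRFilling lam mu nu T) (m e : ℕ) (he : 1 ≤ e) :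
    skN k r lam nu T (m + 1) (e + 1) ≤ skN k r lam nu T m e := by
  obtain ⟨_, _, hrow, _, hyam, _⟩ := hT
  have hc : ∃ c, ∀ j, InSkew lam nu m j → (c ≤ j ↔ e + 1 ≤ T m j) := by
    by_cases hex : ∃ j, InSkew lam nu m j ∧ e + 1 ≤ T m j
    · refine ⟨Nat.find hex, fun j hj => ⟨fun h => ?_, fun h => ?_⟩⟩
      · have h1 := Nat.find_spec hex
        exact h1.2.trans (hrow m _ j h1.1 hj h)
      · exact Nat.find_min' hex ⟨hj, h⟩
    · refine ⟨nu m, fun j hj => ⟨fun h => ?_, fun h => ?_⟩⟩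
      · have := hj.2
        omega
      · exact absurd ⟨j, hj, h⟩ hex
  obtain ⟨c, hc⟩ := hc
  have h := hyam m c e he
  rw [ncard_skD hnuk hnur (fun p => (p.1 < m ∨ (p.1 = m ∧ c ≤ p.2)) ∧ T p.1 p.2 = e + 1),
    ncard_skD hnuk hnur (fun p => (p.1 < m ∨ (p.1 = m ∧ c ≤ p.2)) ∧ T p.1 p.2 = e)] at h
  refine le_trans (card_le_card ?_) (h.trans (card_le_card ?_))
  · rintro ⟨a, b⟩ hp
    simp only [mem_filter, mem_skD hnuk hnur] at hp ⊢
    obtain ⟨h1, h2, h3⟩ := hp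
    refine ⟨h1, ?_, h3⟩
    by_cases ha : a < m
    · exact Or.inl ha
    · have : a = m := by omega
      subst this
      exact Or.inr ⟨rfl, (hc b h1).2 h3.ge⟩
  · rintro ⟨a, b⟩ hp
    simp only [mem_filter, mem_skD hnuk hnur] at hp ⊢
    obtain ⟨h1, h2, h3⟩ := hp
    refine ⟨h1, ?_, h3⟩
    rcases h2 with h2 | ⟨rfl, h2⟩
    · exact h2
    · have := (hc b h1).1 h2
      omega

lemma skN_yam_iter (hnuk : ∀ i, k ≤ i → nu i = 0) (hnur : ∀ i, nu i ≤ r) {T : ℕ → ℕ → ℕ}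
    (hT : IsLRFilling lam mu nu T) (m v d : ℕ) (hv : 1 ≤ v) :
    skN k r lam nu T (m + d) (v + d) ≤ skN k r lam nu T m v := by
  induction d with
  | zero => simp
  | succ d ih => exact (skN_yam hnuk hnur hT (m + d) (v + d) (by omega)).trans ih

lemma skN_one_le (hnuk : ∀ i, k ≤ i → nu i = 0) (hnur : ∀ i, nu i ≤ r)
    (hlam : Antitone lam) {T : ℕ → ℕ → ℕ}
    (hT : IsLRFilling lam mu nu T) (m : ℕ) :
    skN k r lam nu T (m + 1) 1 ≤ r - lam m := by
  obtain ⟨_, _, _, hcol, _, _⟩ := hT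
  rw [← Nat.card_Ico]
  unfold skN
  apply card_le_card_of_injOn (fun p => p.2)
  · rintro ⟨a, b⟩ hp
    simp only [mem_filter, mem_skD hnuk hnur, mem_coe] at hp
    obtain ⟨⟨h1, h1'⟩, h2, h3⟩ := hp
    simp only [coe_Ico, Set.mem_Ico] at *
    have := hlam (show a ≤ m by omega)
    have := hnur a
    omega
  · rintro ⟨a, b⟩ hp ⟨a', b'⟩ hp' hb
    simp only [mem_filter, mem_skD hnuk hnur, mem_coe] at hp hp' hb
    subst hb
    obtain ⟨h1, h2, h3⟩ := hp
    obtain ⟨h1', h2', h3'⟩ := hp'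
    rcases lt_trichotomy a a' with h | h | h
    · have := hcol a a' b h h1 h1'
      omega
    · rw [h]
    · have := hcol a' a b h h1' h1
      omega

lemma skN_le_mu (hnuk : ∀ i, k ≤ i → nu i = 0) (hnur : ∀ i, nu i ≤ r) {T : ℕ → ℕ → ℕ}
    (hT : IsLRFilling lam mu nu T) (m e : ℕ) :
    skN k r lam nu T m (e + 1) ≤ mu e := by
  obtain ⟨_, _, _, _, _, hcont⟩ := hT
  rw [← hcont e, ncard_skD hnuk hnur (fun p => T p.1 p.2 = e + 1)]
  apply card_le_card
  intro p hp
  simp only [mem_filter] at hp ⊢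
  exact ⟨hp.1, hp.2.2⟩

lemma lr_entry_le (hnuk : ∀ i, k ≤ i → nu i = 0) (hnur : ∀ i, nu i ≤ r)
    (hmuk : ∀ i, k ≤ i → mu i = 0) {T : ℕ → ℕ → ℕ}
    (hT : IsLRFilling lam mu nu T) (i j : ℕ) (h : InSkew lam nu i j) : T i j ≤ k := by
  obtain ⟨_, _, _, _, _, hcont⟩ := hT
  by_contra hc
  have h0 := hcont (T i j - 1)
  rw [hmuk _ (by omega), ncard_skD hnuk hnur (fun p => T p.1 p.2 = T i j - 1 + 1),
    card_eq_zero] at h0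
  have : (i, j) ∈ (∅ : Finset (ℕ × ℕ)) := by
    rw [← h0]
    simp only [mem_filter, mem_skD hnuk hnur]
    exact ⟨h, by omega⟩
  simp at this

lemma skN_sum (hnuk : ∀ i, k ≤ i → nu i = 0) (hnur : ∀ i, nu i ≤ r)
    (hmuk : ∀ i, k ≤ i → mu i = 0) {T : ℕ → ℕ → ℕ}
    (hT : IsLRFilling lam mu nu T) (m : ℕ) :
    ∑ e ∈ range k, skN k r lam nu T m (e + 1) =
      ((skD k r lam nu).filter (fun p => p.1 < m)).card := by
  rw [card_eq_sum_card_fiberwise (f := fun p => T p.1 p.2 - 1) (t := range k)]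
  · apply sum_congr rfl
    intro e _
    unfold skN
    congr 1
    ext p
    simp only [mem_filter, mem_skD hnuk hnur]
    constructor
    · rintro ⟨h1, h2, h3⟩
      exact ⟨⟨h1, h2⟩, by omega⟩
    · rintro ⟨⟨h1, h2⟩, h3⟩
      have := hT.2.1 _ _ h1
      exact ⟨h1, h2, by omega⟩
  · intro p hp
    simp only [mem_filter, mem_skD hnuk hnur, mem_coe] at hp
    have := lr_entry_le hnuk hnur hmuk hT _ _ hp.1
    have := hT.2.1 _ _ hp.1
    simp only [mem_coe, mem_range]
    omega

/-- A filling is determined by its row contents. -/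
lemma row_determined (hnur : ∀ i, nu i ≤ r) {T S : ℕ → ℕ → ℕ}
    (hT : IsLRFilling lam mu nu T) (hS : IsLRFilling lam mu nu S) (i : ℕ)
    (h : ∀ e, skR r lam nu T i (e + 1) = skR r lam nu S i (e + 1)) (j : ℕ)
    (hj : InSkew lam nu i j) : S i j ≤ T i j := by
  by_contra hc
  rw [not_le] at hc
  have key : ∀ U : ℕ → ℕ → ℕ, IsLRFilling lam mu nu U →
      ((range r).filter (fun b => InSkew lam nu i b ∧ U i b ≤ T i j)).card
        = ∑ e ∈ range (T i j), skR r lam nu U i (e + 1) := by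
    intro U hU
    rw [card_eq_sum_card_fiberwise (f := fun b => U i b - 1) (t := range (T i j))]
    · apply sum_congr rfl
      intro e he
      rw [mem_range] at he
      unfold skR
      congr 1
      ext b
      simp only [mem_filter]
      constructor
      · rintro ⟨⟨h1, h2, h3⟩, h4⟩
        have := hU.2.1 _ _ h2
        exact ⟨h1, h2, by omega⟩
      · rintro ⟨h1, h2, h3⟩
        exact ⟨⟨h1, h2, by omega⟩, by omega⟩
    · intro b hb
      simp only [mem_filter, mem_coe] at hb
      have := hU.2.1 _ _ hb.2.1
      simp only [mem_coe, mem_range]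
      omega
  have hlt : ((range r).filter (fun b => InSkew lam nu i b ∧ S i b ≤ T i j)).card
      < ((range r).filter (fun b => InSkew lam nu i b ∧ T i b ≤ T i j)).card := by
    apply card_lt_card
    rw [Finset.ssubset_iff_of_subset]
    · refine ⟨j, ?_, ?_⟩
      · simp only [mem_filter, mem_range]
        exact ⟨lt_of_lt_of_le hj.2 (hnur i), hj, le_rfl⟩
      · simp only [mem_filter, not_and]
        intro _ _
        omega
    · intro b hb
      simp only [mem_filter] at hb ⊢
      obtain ⟨h1, h2, h3⟩ := hb
      refine ⟨h1, h2, ?_⟩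
      by_cases hbj : b ≤ j
      · exact hT.2.2.1 i b j h2 hj hbj
      · have := hS.2.2.1 i j b hj h2 (by omega)
        omega
  rw [key T hT, key S hS, sum_congr rfl (fun e _ => h e)] at hlt
  exact lt_irrefl _ hlt

/-- `L i e`: the end of the entries `≤ e` in row `i` of the canonical filling. -/
def skL (r : ℕ) (A B : ℕ → ℕ) (i e : ℕ) : ℕ :=
  ((range r).filter (fun j => i < A j + min e (B j))).card

noncomputable def skT (r : ℕ) (A B lam nu : ℕ → ℕ) (i j : ℕ) : ℕ :=
  if InSkew lam nu i j then sInf {v | j < skL r A B i v} else 0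

variable {A B : ℕ → ℕ}

lemma skL_mono (i : ℕ) {e f : ℕ} (h : e ≤ f) : skL r A B i e ≤ skL r A B i f := by
  apply card_le_card
  intro j
  simp only [mem_filter]
  rintro ⟨h1, h2⟩
  exact ⟨h1, by omega⟩

lemma skL_diag (i e : ℕ) : skL r A B (i + 1) (e + 1) ≤ skL r A B i e := by
  apply card_le_card
  intro j
  simp only [mem_filter]
  rintro ⟨h1, h2⟩
  exact ⟨h1, by omega⟩

lemma skT_le_iff (hBk : ∀ j, B j ≤ k)
    (hnu : ∀ i, nu i = ((range r).filter (fun j => i < A j + B j)).card)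
    {i j : ℕ} (h : InSkew lam nu i j) (v : ℕ) :
    skT r A B lam nu i j ≤ v ↔ j < skL r A B i v := by
  have hne : {v | j < skL r A B i v}.Nonempty := by
    refine ⟨k, ?_⟩
    have : skL r A B i k = nu i := by
      rw [hnu]
      unfold skL
      congr 1
      ext x
      simp only [mem_filter]
      rw [min_eq_right (hBk x)]
    simp only [Set.mem_setOf_eq, this]
    exact h.2
  unfold skT
  rw [if_pos h]
  constructor
  · intro hv
    have h1 : j < skL r A B i (sInf {v | j < skL r A B i v}) := Nat.sInf_mem hne
    exact lt_of_lt_of_le h1 (skL_mono i hv)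
  · intro hv
    exact Nat.sInf_le hv

lemma skL_zero (hlamr : ∀ i, lam i ≤ r) (hA : ∀ i j, i < A j ↔ j < lam i) (i : ℕ) :
    skL r A B i 0 = lam i := by
  unfold skL
  rw [show (range r).filter (fun j => i < A j + min 0 (B j)) = range (lam i) from ?_, card_range]
  ext j
  have := hlamr i
  have := hA i j
  simp only [mem_filter, mem_range]
  simp only [Nat.zero_min, add_zero]
  omega

lemma skL_le_nu (hnu : ∀ i, nu i = ((range r).filter (fun j => i < A j + B j)).card) (i e : ℕ) :
    skL r A B i e ≤ nu i := by
  rw [hnu]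
  apply card_le_card
  intro j
  simp only [mem_filter]
  rintro ⟨h1, h2⟩
  exact ⟨h1, by omega⟩

lemma skR_skT (hBk : ∀ j, B j ≤ k)
    (hnu : ∀ i, nu i = ((range r).filter (fun j => i < A j + B j)).card)
    (hlamr : ∀ i, lam i ≤ r) (hA : ∀ i j, i < A j ↔ j < lam i) (hnur : ∀ i, nu i ≤ r) (i e : ℕ) :
    skR r lam nu (skT r A B lam nu) i (e + 1) =
      ((range r).filter (fun j => e < B j ∧ A j + e = i)).card := by
  have h1 : skR r lam nu (skT r A B lam nu) i (e + 1)
      = (Ico (skL r A B i e) (skL r A B i (e + 1))).card := by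
    unfold skR
    congr 1
    ext j
    simp only [mem_filter, mem_range, mem_Ico]
    have hle := skL_le_nu hnu i (e + 1)
    have h0 : lam i ≤ skL r A B i e := by
      rw [← skL_zero (B := B) hlamr hA i]
      exact skL_mono i (Nat.zero_le _)
    constructor
    · rintro ⟨_, h2, h3⟩
      have a1 := skT_le_iff hBk hnu h2 e
      have a2 := skT_le_iff hBk hnu h2 (e + 1)
      omega
    · rintro ⟨h2, h3⟩
      have hs : InSkew lam nu i j := ⟨by omega, by omega⟩
      have a1 := skT_le_iff hBk hnu hs e
      have a2 := skT_le_iff hBk hnu hs (e + 1)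
      have := hnur i
      refine ⟨by omega, hs, by omega⟩
  rw [h1, Nat.card_Ico]
  unfold skL
  rw [← card_sdiff_of_subset]
  · congr 1
    ext j
    simp only [mem_sdiff, mem_filter, mem_range]
    omega
  · intro j
    simp only [mem_filter]
    rintro ⟨h1, h2⟩
    exact ⟨h1, by omega⟩

lemma skN_skT (hBk : ∀ j, B j ≤ k)
    (hnu : ∀ i, nu i = ((range r).filter (fun j => i < A j + B j)).card)
    (hlamr : ∀ i, lam i ≤ r) (hA : ∀ i j, i < A j ↔ j < lam i)
    (hnuk : ∀ i, k ≤ i → nu i = 0) (hnur : ∀ i, nu i ≤ r) (m e : ℕ) :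
    skN k r lam nu (skT r A B lam nu) m (e + 1) =
      ((range r).filter (fun j => e < B j ∧ A j + e < m)).card := by
  induction m with
  | zero => rw [skN_zero]; simp
  | succ m ih =>
    rw [skN_succ hnuk hnur, ih, skR_skT hBk hnu hlamr hA hnur, ← card_union_of_disjoint]
    · congr 1
      ext j
      simp only [mem_union, mem_filter, mem_range]
      omega
    · rw [disjoint_left]
      intro j
      simp only [mem_filter]
      omega

lemma skT_isLR (hBk : ∀ j, B j ≤ k) (hABk : ∀ j, j < r → A j + B j ≤ k)
    (hnu : ∀ i, nu i = ((range r).filter (fun j => i < A j + B j)).card)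
    (hlamr : ∀ i, lam i ≤ r) (hA : ∀ i j, i < A j ↔ j < lam i)
    (hmur : ∀ i, mu i ≤ r) (hB : ∀ i j, j < r → (i < B j ↔ r - 1 - j < mu i))
    (hnuk : ∀ i, k ≤ i → nu i = 0) (hnur : ∀ i, nu i ≤ r) :
    IsLRFilling lam mu nu (skT r A B lam nu) := by
  have hN := skN_skT (lam := lam) hBk hnu hlamr hA hnuk hnur
  refine ⟨?_, ?_, ?_, ?_, ?_, ?_⟩
  · intro i j h
    unfold skT
    rw [if_neg h]
  · intro i j h
    have h1 := skT_le_iff hBk hnu h 0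
    rw [skL_zero hlamr hA] at h1
    have := h.1
    omega
  · intro i j1 j2 h1 h2 h12
    rw [skT_le_iff hBk hnu h1]
    exact lt_of_le_of_lt h12 ((skT_le_iff hBk hnu h2 _).1 le_rfl)
  · intro i1 i2 j h12 h1 h2
    have hpos : 1 ≤ skT r A B lam nu i2 j := by
      have h3 := skT_le_iff hBk hnu h2 0
      rw [skL_zero hlamr hA] at h3
      have := h2.1
      omega
    obtain ⟨v, hv⟩ : ∃ v, skT r A B lam nu i2 j = v + 1 := ⟨_, (Nat.sub_add_cancel hpos).symm⟩
    have h4 := (skT_le_iff hBk hnu h2 (v + 1)).1 hv.le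
    have h5 : skL r A B i2 (v + 1) ≤ skL r A B i1 v := by
      apply card_le_card
      intro j
      simp only [mem_filter]
      rintro ⟨h1, h2⟩
      exact ⟨h1, by omega⟩
    rw [hv, Nat.lt_succ_iff, skT_le_iff hBk hnu h1]
    omega
  · intro m c e he
    obtain ⟨f, rfl⟩ : ∃ f, e = f + 1 := ⟨e - 1, by omega⟩
    set T := skT r A B lam nu with hT
    rw [ncard_skD hnuk hnur (fun p => (p.1 < m ∨ (p.1 = m ∧ c ≤ p.2)) ∧ T p.1 p.2 = f + 1 + 1),
      ncard_skD hnuk hnur (fun p => (p.1 < m ∨ (p.1 = m ∧ c ≤ p.2)) ∧ T p.1 p.2 = f + 1)]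
    have h1 : skN k r lam nu T (m + 1) (f + 1 + 1) ≤ skN k r lam nu T m (f + 1) := by
      rw [hN, hN]
      apply card_le_card
      intro j
      simp only [mem_filter]
      rintro ⟨h1, h2, h3⟩
      exact ⟨h1, by omega, by omega⟩
    refine le_trans (card_le_card ?_) (h1.trans (card_le_card ?_))
    · intro p
      simp only [mem_filter]
      rintro ⟨h1, h2, h3⟩
      exact ⟨h1, by omega, h3⟩
    · intro p
      simp only [mem_filter]
      rintro ⟨h1, h2, h3⟩
      exact ⟨h1, by omega, h3⟩
  · intro e
    set T := skT r A B lam nu with hT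
    rw [ncard_skD hnuk hnur (fun p => T p.1 p.2 = e + 1)]
    have h1 : ((skD k r lam nu).filter (fun p => T p.1 p.2 = e + 1)).card
        = skN k r lam nu T k (e + 1) := by
      unfold skN
      congr 1
      ext p
      simp only [mem_filter, and_congr_right_iff]
      intro hp
      have : p.1 < k := by
        unfold skD at hp
        simp only [mem_filter, mem_product, mem_range] at hp
        exact hp.1.1
      simp [this]
    refine Eq.trans (b := skN k r lam nu T k (e + 1)) (by convert h1) ?_
    rw [hN]
    have h2 : (range r).filter (fun j => e < B j ∧ A j + e < k) = Ico (r - mu e) r := by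
      ext j
      simp only [mem_filter, mem_range, mem_Ico]
      constructor
      · rintro ⟨h1, h2, h3⟩
        have := hB e j h1
        omega
      · rintro ⟨h1, h2⟩
        have := hB e j h2
        have := hABk j h2
        omega
    rw [h2, Nat.card_Ico]
    have := hmur e
    omega

lemma skN_upper (hBk : ∀ j, B j ≤ k)
    (hnu : ∀ i, nu i = ((range r).filter (fun j => i < A j + B j)).card)
    (hlam : Antitone lam)
    (hlamr : ∀ i, lam i ≤ r) (hA : ∀ i j, i < A j ↔ j < lam i)
    (hmur : ∀ i, mu i ≤ r) (hB : ∀ i j, j < r → (i < B j ↔ r - 1 - j < mu i))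
    (hnuk : ∀ i, k ≤ i → nu i = 0) (hnur : ∀ i, nu i ≤ r)
    {T : ℕ → ℕ → ℕ} (hT : IsLRFilling lam mu nu T) (m e : ℕ) :
    skN k r lam nu T m (e + 1) ≤ skN k r lam nu (skT r A B lam nu) m (e + 1) := by
  rw [skN_skT (lam := lam) hBk hnu hlamr hA hnuk hnur]
  by_cases hme : m ≤ e
  · have h := skN_yam_iter hnuk hnur hT 0 (e + 1 - m) m (by omega)
    rw [skN_zero, zero_add, Nat.sub_add_cancel (by omega)] at h
    omega
  · obtain ⟨d, rfl⟩ : ∃ d, m = d + 1 + e := ⟨m - 1 - e, by omega⟩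
    have h1 := skN_yam_iter hnuk hnur hT (d + 1) 1 e le_rfl
    have h2 := skN_one_le hnuk hnur hlam hT d
    have h3 := skN_le_mu hnuk hnur hT (d + 1 + e) e
    have h4 : (range r).filter (fun j => e < B j ∧ A j + e < d + 1 + e)
        = Ico (max (r - mu e) (lam d)) r := by
      ext j
      simp only [mem_filter, mem_range, mem_Ico]
      have a1 := hA d j
      constructor
      · rintro ⟨h1, h2, h3⟩
        have := hB e j h1
        omega
      · rintro ⟨h1, h2⟩
        have := hB e j h2
        omega
    rw [h4, Nat.card_Ico]
    have := hmur e
    have := hlamr d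
    rw [add_comm e 1]
    rw [add_comm e 1] at h3
    omega

lemma lr_core (hBk : ∀ j, B j ≤ k) (hABk : ∀ j, j < r → A j + B j ≤ k)
    (hnu : ∀ i, nu i = ((range r).filter (fun j => i < A j + B j)).card)
    (hlam : Antitone lam)
    (hlamr : ∀ i, lam i ≤ r) (hA : ∀ i j, i < A j ↔ j < lam i)
    (hmur : ∀ i, mu i ≤ r) (hB : ∀ i j, j < r → (i < B j ↔ r - 1 - j < mu i))
    (hmuk : ∀ i, k ≤ i → mu i = 0)
    (hnuk : ∀ i, k ≤ i → nu i = 0) (hnur : ∀ i, nu i ≤ r) :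
    lrCoeff lam mu nu = 1 := by
  have hS := skT_isLR (lam := lam) (mu := mu) hBk hABk hnu hlamr hA hmur hB hnuk hnur
  unfold lrCoeff
  rw [Set.ncard_eq_one]
  refine ⟨skT r A B lam nu, ?_⟩
  ext T
  simp only [Set.mem_setOf_eq, Set.mem_singleton_iff]
  refine ⟨fun hT => ?_, fun h => h ▸ hS⟩
  have hNeq : ∀ m e, skN k r lam nu T m (e + 1)
      = skN k r lam nu (skT r A B lam nu) m (e + 1) := by
    intro m e
    have hle := skN_upper hBk hnu hlam hlamr hA hmur hB hnuk hnur hT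
    by_cases he : e < k
    · have hsum := (skN_sum hnuk hnur hmuk hT m).trans (skN_sum hnuk hnur hmuk hS m).symm
      exact (sum_eq_sum_iff_of_le (fun e _ => hle m e)).1 hsum e (mem_range.2 he)
    · have h1 := skN_le_mu hnuk hnur hT m e
      have h2 := skN_le_mu hnuk hnur hS m e
      rw [hmuk e (by omega)] at h1 h2
      omega
  have hReq : ∀ m e, skR r lam nu T m (e + 1) = skR r lam nu (skT r A B lam nu) m (e + 1) := by
    intro m e
    have h1 := hNeq (m + 1) e
    rw [skN_succ hnuk hnur, skN_succ hnuk hnur, hNeq m e] at h1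
    omega
  funext i j
  by_cases h : InSkew lam nu i j
  · exact le_antisymm (row_determined hnur hS hT i (fun e => (hReq i e).symm) j h)
      (row_determined hnur hT hS i (hReq i) j h)
  · rw [hT.1 i j h, hS.1 i j h]

end core

lemma sum_card_aux (k r : ℕ) (b : ℕ → ℕ) (hb : ∀ j, j < r → b j ≤ k) :
    ∑ i ∈ Finset.range k, ((Finset.range r).filter (fun j => i < b j)).card
      = ∑ j ∈ Finset.range r, b j := by
  simp_rw [Finset.card_filter]
  rw [Finset.sum_comm]
  apply Finset.sum_congr rfl
  intro j hj
  rw [Finset.mem_range] at hj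
  rw [← Finset.card_filter, show (Finset.range k).filter (fun i => i < b j)
    = Finset.range (b j) from ?_, Finset.card_range]
  ext i
  have := hb j hj
  simp only [Finset.mem_filter, Finset.mem_range]
  omega

lemma sum_conj_aux (k r : ℕ) (p : ℕ → ℕ) (hp : IsRectPartition k r p) :
    ∑ j ∈ Finset.range r, conj p j = ∑ i ∈ Finset.range k, p i := by
  have hc := conj_iff_aux p k hp.1 hp.2.1
  rw [← sum_card_aux k r (conj p)]
  · apply Finset.sum_congr rfl
    intro i _
    rw [show (Finset.range r).filter (fun j => i < conj p j) = Finset.range (p i) from ?_,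
      Finset.card_range]
    ext j
    have := hp.2.2 i
    have := hc i j
    simp only [Finset.mem_filter, Finset.mem_range]
    omega
  · intro j _
    by_contra h
    have h1 := (hc k j).1 (by omega)
    rw [hp.2.1 k le_rfl] at h1
    omega

/-- For `λ`, `μ` in the `k × (n−k)` rectangle with
`λ_i + μ_{k+1−i} ≤ n−k` for all `1 ≤ i ≤ k`, the explicit partition
`ν(λ,μ) = (ρ(λ,μ)')^∨` fits in the rectangle, has `|ν| = |λ| + |μ|`,
and satisfies `c_{λμ}^{ν(λ,μ)} = 1`. -/
theorem lrCoeff_nuFun_eq_one (n k : ℕ) (hk : 0 < k) (hkn : k < n)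
    (lam mu : ℕ → ℕ)
    (hlam : IsRectPartition k (n - k) lam) (hmu : IsRectPartition k (n - k) mu)
    (hno : ∀ i, i < k → lam i + mu (k - 1 - i) ≤ n - k) :
    IsRectPartition k (n - k) (nuFun n k lam mu) ∧
      (∑ i ∈ Finset.range k, nuFun n k lam mu i) =
        (∑ i ∈ Finset.range k, lam i) + (∑ i ∈ Finset.range k, mu i) ∧
      lrCoeff lam mu (nuFun n k lam mu) = 1 := by
  have hA := conj_iff_aux lam k hlam.1 hlam.2.1
  have hM := conj_iff_aux mu k hmu.1 hmu.2.1
  have hconjk : ∀ p : ℕ → ℕ, IsRectPartition k (n - k) p → ∀ j, conj p j ≤ k := by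
    intro p hp j
    by_contra h
    have h1 := (conj_iff_aux p k hp.1 hp.2.1 k j).1 (by omega)
    rw [hp.2.1 k le_rfl] at h1
    omega
  have hmuanti : Antitone mu := antitone_nat_of_succ_le hmu.1
  set r := n - k with hr
  set B : ℕ → ℕ := fun j => conj mu (r - 1 - j) with hBdef
  have hABk : ∀ j, j < r → conj lam j + B j ≤ k := by
    intro j hj
    by_contra h
    have ha := hconjk lam hlam j
    have hb : B j ≤ k := hconjk mu hmu (r - 1 - j)
    have h1 := (hA (conj lam j - 1) j).1 (by omega)
    have h2 : r - 1 - j < mu (B j - 1) := (hM (B j - 1) (r - 1 - j)).1 (by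
      change B j - 1 < B j
      omega)
    have h3 := hno (conj lam j - 1) (by omega)
    have h4 := hmuanti (show k - 1 - (conj lam j - 1) ≤ B j - 1 by omega)
    omega
  have hnu : ∀ i, nuFun n k lam mu i
      = ((Finset.range r).filter (fun j => i < conj lam j + B j)).card := by
    intro i
    unfold nuFun
    split_ifs with hi
    · rw [conj_rho_aux, ← hr]
      have hadd := Finset.card_filter_add_card_filter_not (s := Finset.range r)
        (fun j => i < conj lam j + B j)
      rw [Finset.card_range] at hadd
      have heq : (Finset.range r).filter
          (fun j => k - 1 - i < k - conj lam j - conj mu (r - 1 - j))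
          = (Finset.range r).filter (fun j => ¬ i < conj lam j + B j) := by
        apply Finset.filter_congr
        intro j hj
        have := hABk j (Finset.mem_range.1 hj)
        simp only [hBdef] at this ⊢
        omega
      rw [heq]
      omega
    · symm
      rw [Finset.card_eq_zero, Finset.filter_eq_empty_iff]
      intro j hj
      have := hABk j (Finset.mem_range.1 hj)
      omega
  have hnuk : ∀ i, k ≤ i → nuFun n k lam mu i = 0 := by
    intro i hi
    unfold nuFun
    rw [if_neg (by omega)]
  have hnur : ∀ i, nuFun n k lam mu i ≤ r := by
    intro i
    rw [hnu]
    exact (Finset.card_filter_le _ _).trans (Finset.card_range r).le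
  refine ⟨⟨?_, hnuk, hnur⟩, ?_, ?_⟩
  · intro i
    rw [hnu, hnu]
    apply Finset.card_le_card
    intro j
    simp only [Finset.mem_filter]
    rintro ⟨h1, h2⟩
    exact ⟨h1, by omega⟩
  · rw [Finset.sum_congr rfl (fun i _ => hnu i),
      sum_card_aux k r (fun j => conj lam j + B j) hABk, Finset.sum_add_distrib,
      sum_conj_aux k r lam hlam, ← sum_conj_aux k r mu hmu]
    congr 1
    exact Finset.sum_range_reflect (conj mu) r
  · exact lr_core (A := conj lam) (B := B) (k := k) (r := r)
      (fun j => hconjk mu hmu _) hABk hnu (antitone_nat_of_succ_le hlam.1) hlam.2.2 hA hmu.2.2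
      (fun i j _ => hM i _) hmu.2.1 hnuk hnur
end

section
/- Let 0 < k < n be integers and let λ and μ be partitions fitting in the k×(n−k) rectangle such that λ_i + μ_{k+1−i} ≤ n−k for all 1 ≤ i ≤ k. Let ρ = ρ(λ,μ) be the partition obtained by sorting the numbers k − λ'_j − μ'_{n−k+1−j} (for j = 1, …, n−k) into weakly decreasing order, and set ν(λ,μ) = (ρ')^∨. Then there exists at least one Littlewood–Richardson filling of the skew shape ν(λ,μ)/λ of content μ; that is, c_{λμ}^{ν(λ,μ)} ≥ 1. -/
lemma lr_conj_lt_iff (k r : ℕ) (p : ℕ → ℕ) (h : IsRectPartition k r p) (i j : ℕ) :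
    i < conj p j ↔ j < p i := by
  obtain ⟨h1, h2, h3⟩ := h
  have hanti : Antitone p := antitone_nat_of_succ_le h1
  have hex : ∃ N, p N ≤ j := ⟨k, by rw [h2 k le_rfl]; exact Nat.zero_le _⟩
  classical
  have hset : {i : ℕ | j < p i} = ((Finset.range (Nat.find hex) : Finset ℕ) : Set ℕ) := by
    ext x
    simp only [Set.mem_ofPred_eq, Finset.coe_range, Set.mem_Iio]
    constructor
    · intro hx
      by_contra hc
      have := hanti (not_lt.mp hc)
      have := Nat.find_spec hex
      omega
    · intro hx
      have := Nat.find_min hex hx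
      omega
  have hc : conj p j = Nat.find hex := by
    unfold conj
    rw [hset, Set.ncard_coe_finset, Finset.card_range]
  have hm : i ∈ {i : ℕ | j < p i} ↔ i < Nat.find hex := by
    rw [hset]; simp
  rw [hc, ← hm]; rfl

lemma lr_ncard_getD (m : ℕ) (L : List ℕ) :
    Set.ncard {x : ℕ | m < L.getD x 0} = L.countP (fun y => decide (m < y)) ∧
    {x : ℕ | m < L.getD x 0}.Finite := by
  induction L with
  | nil => simp
  | cons a L ih =>
    obtain ⟨ih1, ih2⟩ := ih
    have hinj : Function.Injective Nat.succ := Nat.succ_injective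
    by_cases ha : m < a
    · have hs : {x : ℕ | m < (a :: L).getD x 0}
          = insert 0 (Nat.succ '' {x : ℕ | m < L.getD x 0}) := by
        ext x
        cases x with
        | zero => simp [ha]
        | succ x => simp
      rw [hs]
      refine ⟨?_, (ih2.image _).insert _⟩
      rw [Set.ncard_insert_of_notMem (by simp) (ih2.image _), Set.ncard_image_of_injective _ hinj,
        ih1]
      simp [ha]
    · have hs : {x : ℕ | m < (a :: L).getD x 0}
          = (Nat.succ '' {x : ℕ | m < L.getD x 0}) := by
        ext x
        cases x with
        | zero => simp [ha]
        | succ x => simp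
      rw [hs]
      refine ⟨?_, (ih2.image _)⟩
      rw [Set.ncard_image_of_injective _ hinj, ih1]
      simp [ha]

lemma lr_count_range (r : ℕ) (P : ℕ → Prop) [DecidablePred P] :
    r - (List.range r).countP (fun j => decide (¬ P j)) = Nat.count P r := by
  have h := List.length_eq_countP_add_countP (fun j => decide (P j)) (l := List.range r)
  have h2 : Nat.count P r = (List.range r).countP (fun j => decide (P j)) := by
    rw [Nat.count_eq_card_filter_range, List.countP_eq_length_filter]
    rfl
  rw [List.length_range] at h
  have h3 : (List.range r).countP (fun j => decide (¬ P j)) =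
    (List.range r).countP (fun j => decide (¬ (decide (P j) = true))) := by
    congr 1; funext j; simp
  omega

lemma lr_nth (r p : ℕ) (P : ℕ → Prop) [DecidablePred P] (hp : p < Nat.count P r) :
    P (Nat.nth P p) ∧ Nat.count P (Nat.nth P p) = p ∧ Nat.nth P p < r := by
  have h : ∀ hf : {x | P x}.Finite, p < hf.toFinset.card := by
    intro hf
    refine lt_of_lt_of_le hp ?_
    rw [Nat.count_eq_card_filter_range]
    apply Finset.card_le_card
    intro x hx
    simp at hx ⊢
    exact hx.2
  exact ⟨Nat.nth_mem p h, Nat.count_nth h, Nat.nth_lt_of_lt_count hp⟩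

lemma lr_nuFun (n k : ℕ) (lam mu : ℕ → ℕ)
    (hab : ∀ j, j < n - k → conj lam j + conj mu (n - k - 1 - j) ≤ k) (i : ℕ) :
    nuFun n k lam mu i =
      Nat.count (fun j => j < n - k ∧ i < conj lam j + conj mu (n - k - 1 - j)) (n - k) := by
  unfold nuFun
  split_ifs with hi
  · have h := (lr_ncard_getD (k - 1 - i) (List.insertionSort (· ≥ ·)
      ((List.range (n - k)).map fun j => k - conj lam j - conj mu (n - k - 1 - j)))).1
    have h' : conj (rhoFun n k lam mu) (k - 1 - i) = _ := h
    rw [h', (List.perm_insertionSort _ _).countP_eq, List.countP_map,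
      ← lr_count_range]
    congr 1
    apply List.countP_congr
    intro j hj
    have hj' := List.mem_range.mp hj
    have := hab j hj'
    simp only [Function.comp, decide_eq_true_eq]
    omega
  · symm
    rw [Nat.count_eq_card_filter_range, Finset.card_eq_zero, Finset.filter_eq_empty_iff]
    rintro x hx ⟨h1, h2⟩
    have := hab x h1
    omega

lemma lr_finite (k r : ℕ) (lam mu nu : ℕ → ℕ) (hmu : ∀ i, k ≤ i → mu i = 0)
    (hnu0 : ∀ i, k ≤ i → nu i = 0) (hnu : ∀ i, nu i ≤ r) :
    {T : ℕ → ℕ → ℕ | IsLRFilling lam mu nu T}.Finite := by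
  classical
  have hsk : {p : ℕ × ℕ | InSkew lam nu p.1 p.2}.Finite := by
    apply ((Set.finite_Iio k).prod (Set.finite_Iio r)).subset
    rintro ⟨i, j⟩ ⟨h1, h2⟩
    simp only [Set.mem_prod, Set.mem_Iio] at *
    have := hnu i
    refine ⟨?_, by omega⟩
    by_contra hc
    have := hnu0 i (by omega)
    omega
  let F : (ℕ → ℕ → ℕ) → (Fin k → Fin r → ℕ) := fun T i j => T i j
  have hfin : (Set.univ.pi fun _ : Fin k => Set.univ.pi fun _ : Fin r => Set.Iic k).Finite :=
    Set.Finite.pi fun _ => Set.Finite.pi fun _ => Set.finite_Iic k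
  apply Set.Finite.of_finite_image (f := F) (hfin.subset _)
  · intro T hT T' hT' h
    funext i j
    by_cases hs : InSkew lam nu i j
    · have hj : j < r := lt_of_lt_of_le hs.2 (hnu i)
      have hi : i < k := by
        by_contra hc
        have := hnu0 i (by omega)
        have := hs.2
        omega
      exact congrFun (congrFun h ⟨i, hi⟩) ⟨j, hj⟩
    · rw [hT.1 i j hs, hT'.1 i j hs]
  · rintro _ ⟨T, hT, rfl⟩
    intro i _ j _
    show T i j ≤ k
    by_contra hc
    obtain ⟨e, he⟩ : ∃ e, T i j = e + 1 := ⟨T i j - 1, by omega⟩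
    have h := hT.2.2.2.2.2 e
    rw [hmu e (by omega), Set.ncard_eq_zero (hsk.subset fun p hp => hp.1)] at h
    have hs : InSkew lam nu i j := by
      by_contra hs
      have := hT.1 i j hs
      omega
    have : ((i : ℕ), (j : ℕ)) ∈ (∅ : Set (ℕ × ℕ)) := by
      rw [← h]; exact ⟨hs, he⟩
    exact this

open Classical in
lemma lr_exists (k r : ℕ) (lam mu nu a b : ℕ → ℕ)
    (hmur : ∀ e, mu e ≤ r)
    (ha : ∀ i j, i < a j ↔ j < lam i)
    (hlamr : ∀ i, lam i ≤ r)
    (hb : ∀ i j, j < r → (i < b j ↔ r - 1 - j < mu i))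
    (hab : ∀ j, j < r → a j + b j ≤ k)
    (hnu : ∀ i, nu i = Nat.count (fun j => j < r ∧ i < a j + b j) r) :
    ∃ T, IsLRFilling lam mu nu T := by
  let P : ℕ → ℕ → Prop := fun i j => j < r ∧ i < a j + b j
  let J : ℕ → ℕ → ℕ := fun i p => Nat.nth (P i) p
  have hsk : {p : ℕ × ℕ | InSkew lam nu p.1 p.2}.Finite := by
    apply ((Set.finite_Iio k).prod (Set.finite_Iio r)).subset
    rintro ⟨i, j⟩ ⟨h1, h2⟩
    simp only at h1 h2
    have h3 : j < Nat.count (P i) r := by rw [← hnu]; exact h2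
    obtain ⟨h4, h5, h6⟩ := lr_nth r j (P i) h3
    have h7 := hab _ h6
    have h8 := h4.2
    have h9 := Nat.count_le (p := P i) (n := r)
    simp only [Set.mem_prod, Set.mem_Iio]
    omega
  -- facts about J
  have hJ : ∀ i p, InSkew lam nu i p →
      J i p < r ∧ i < a (J i p) + b (J i p) ∧ a (J i p) ≤ i ∧ Nat.count (P i) (J i p) = p := by
    rintro i p ⟨h1, h2⟩
    have h3 : p < Nat.count (P i) r := by rw [← hnu]; exact h2
    obtain ⟨h4, h5, h6⟩ := lr_nth r p (P i) h3
    refine ⟨h6, h4.2, ?_, h5⟩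
    by_contra hc
    have h7 := (ha i (J i p)).1 (by omega)
    have h8 := Nat.count_le (p := P i) (n := J i p)
    have h9 : Nat.count (P i) (J i p) = p := h5
    omega
  -- inverse
  have hI : ∀ i j, j < r → a j ≤ i → i < a j + b j →
      InSkew lam nu i (Nat.count (P i) j) ∧ J i (Nat.count (P i) j) = j := by
    intro i j hj h1 h2
    have hP : P i j := ⟨hj, h2⟩
    refine ⟨⟨?_, ?_⟩, Nat.nth_count hP⟩
    · have h3 : lam i ≤ j := by
        by_contra hc
        have := (ha i j).2 (by omega)
        omega
      refine le_trans ?_ (Nat.count_monotone (P i) h3)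
      have h4 : Nat.count (P i) (lam i) = lam i := by
        rw [Nat.count_iff_forall]
        intro x hx
        have h5 := (ha i x).2 hx
        have h6 := hlamr i
        exact ⟨by omega, by omega⟩
      omega
    · rw [hnu]
      exact Nat.count_strict_mono hP hj
  have hrow : ∀ i p q, InSkew lam nu i p → InSkew lam nu i q → p ≤ q → J i p ≤ J i q := by
    intro i p q hp hq hpq
    by_contra hc
    obtain ⟨h1, h2, h3, h4⟩ := hJ i p hp
    obtain ⟨g1, g2, g3, g4⟩ := hJ i q hq
    have := Nat.count_strict_mono (p := P i) ⟨g1, g2⟩ (not_le.mp hc)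
    omega
  have hcol : ∀ i i' p, i < i' → InSkew lam nu i p → InSkew lam nu i' p → J i p ≤ J i' p := by
    intro i i' p hii hp hq
    by_contra hc
    obtain ⟨h1, h2, h3, h4⟩ := hJ i p hp
    obtain ⟨g1, g2, g3, g4⟩ := hJ i' p hq
    have h5 := Nat.count_strict_mono (p := P i) ⟨g1, by omega⟩ (not_le.mp hc)
    have h6 : Nat.count (P i') (J i' p) ≤ Nat.count (P i) (J i' p) :=
      Nat.count_mono_left (fun x _ hx => ⟨hx.1, by have := hx.2; omega⟩)
    omega
  have haanti : ∀ x y, x ≤ y → a y ≤ a x := by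
    intro x y hxy
    by_contra hc
    have h1 := (ha (a x) y).1 (by omega)
    have h2 := (ha (a x) x).2 (by omega)
    omega
  let T : ℕ → ℕ → ℕ := fun i p => if InSkew lam nu i p then i - a (J i p) + 1 else 0
  have hT : ∀ i p, InSkew lam nu i p → T i p = i - a (J i p) + 1 := by
    intro i p h
    exact if_pos h
  refine ⟨T, ?_, ?_, ?_, ?_, ?_, ?_⟩
  · intro i j h
    exact if_neg h
  · intro i j h
    rw [hT i j h]; omega
  · intro i p q hp hq hpq
    rw [hT i p hp, hT i q hq]
    have := haanti _ _ (hrow i p q hp hq hpq)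
    omega
  · intro i i' p hii hp hq
    rw [hT i p hp, hT i' p hq]
    have := haanti _ _ (hcol i i' p hii hp hq)
    have := (hJ i p hp).2.2.1
    omega
  · intro m c e he
    refine Set.ncard_le_ncard_of_injOn
      (fun p => (p.1 - 1, Nat.count (P (p.1 - 1)) (J p.1 p.2))) ?_ ?_
      (hsk.subset fun p hp => hp.1)
    · rintro ⟨i, p⟩ ⟨h1, h2, h3⟩
      simp only at h1 h2 h3
      rw [hT i p h1] at h3
      obtain ⟨g1, g2, g3, g4⟩ := hJ i p h1
      obtain ⟨f1, f2⟩ := hI (i - 1) (J i p) g1 (by omega) (by omega)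
      refine ⟨f1, Or.inl ?_, ?_⟩
      · show i - 1 < m
        omega
      · show T (i - 1) (Nat.count (P (i - 1)) (J i p)) = e
        rw [hT _ _ f1, f2]
        omega
    · rintro ⟨i, p⟩ ⟨h1, h2, h3⟩ ⟨i', p'⟩ ⟨h1', h2', h3'⟩ heq
      simp only [Prod.mk.injEq] at h1 h2 h3 h1' h2' h3' heq
      rw [hT i p h1] at h3
      rw [hT i' p' h1'] at h3'
      obtain ⟨g1, g2, g3, g4⟩ := hJ i p h1
      obtain ⟨g1', g2', g3', g4'⟩ := hJ i' p' h1'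
      obtain ⟨f1, f2⟩ := hI (i - 1) (J i p) g1 (by omega) (by omega)
      obtain ⟨f1', f2'⟩ := hI (i' - 1) (J i' p') g1' (by omega) (by omega)
      have hi : i = i' := by omega
      subst hi
      have hj : J i p = J i p' := by
        rw [← f2, ← f2', heq.2]
      rw [← g4, ← g4', hj]
  · intro e
    have hcard : Set.ncard (((Finset.Ico (r - mu e) r : Finset ℕ)) : Set ℕ) = mu e := by
      rw [Set.ncard_coe_finset, Nat.card_Ico]
      have := hmur e
      omega
    rw [← hcard]
    refine Set.ncard_congr (fun p _ => J p.1 p.2) ?_ ?_ ?_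
    · rintro ⟨i, p⟩ ⟨h1, h3⟩
      simp only at h1 h3
      rw [hT i p h1] at h3
      obtain ⟨g1, g2, g3, g4⟩ := hJ i p h1
      have := (hb e (J i p) g1).1 (by omega)
      simp only [Finset.coe_Ico, Set.mem_Ico]
      omega
    · rintro ⟨i, p⟩ ⟨i', p'⟩ ⟨h1, h3⟩ ⟨h1', h3'⟩ heq
      simp only at h1 h3 h1' h3' heq
      rw [hT i p h1] at h3
      rw [hT i' p' h1'] at h3'
      obtain ⟨g1, g2, g3, g4⟩ := hJ i p h1
      obtain ⟨g1', g2', g3', g4'⟩ := hJ i' p' h1'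
      rw [heq] at h3 g3
      have hi : i = i' := by omega
      subst hi
      rw [← g4, ← g4', heq]
    · intro j hj
      simp only [Finset.coe_Ico, Set.mem_Ico] at hj
      have hbj := (hb e j hj.2).2 (by omega)
      obtain ⟨f1, f2⟩ := hI (a j + e) j hj.2 (by omega) (by omega)
      refine ⟨(a j + e, Nat.count (P (a j + e)) j), ⟨f1, ?_⟩, f2⟩
      show T (a j + e) (Nat.count (P (a j + e)) j) = e + 1
      rw [hT _ _ f1, f2]
      omega

/-- For `λ`, `μ` in the `k × (n−k)` rectangle with
`λ_i + μ_{k+1−i} ≤ n−k` for all `1 ≤ i ≤ k`, there is at least one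
Littlewood–Richardson filling of `ν(λ,μ)/λ` of content `μ`; that is,
`c_{λμ}^{ν(λ,μ)} ≥ 1`. -/
theorem one_le_lrCoeff_nuFun (n k : ℕ) (hk : 0 < k) (hkn : k < n)
    (lam mu : ℕ → ℕ)
    (hlam : IsRectPartition k (n - k) lam) (hmu : IsRectPartition k (n - k) mu)
    (hno : ∀ i, i < k → lam i + mu (k - 1 - i) ≤ n - k) :
    1 ≤ lrCoeff lam mu (nuFun n k lam mu) := by
  classical
  have hA := lr_conj_lt_iff k (n - k) lam hlam
  have hB := lr_conj_lt_iff k (n - k) mu hmu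
  have hab : ∀ j, j < n - k → conj lam j + conj mu (n - k - 1 - j) ≤ k := by
    intro j hj
    by_contra hc
    have ha : conj lam j ≤ k := by
      by_contra h
      have h1 := (hA k j).1 (by omega)
      have h2 := hlam.2.1 k le_rfl
      omega
    have h1 := (hB (k - conj lam j) (n - k - 1 - j)).1 (by omega)
    rcases Nat.eq_zero_or_pos (conj lam j) with h0 | h0
    · have h2 := hmu.2.1 (k - conj lam j) (by omega)
      omega
    · have h2 := (hA (conj lam j - 1) j).1 (by omega)
      have h3 := hno (conj lam j - 1) (by omega)
      have h4 : k - 1 - (conj lam j - 1) = k - conj lam j := by omega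
      rw [h4] at h3
      omega
  have hnu := lr_nuFun n k lam mu hab
  have hfin := lr_finite k (n - k) lam mu (nuFun n k lam mu) hmu.2.1
    (fun i hi => by unfold nuFun; rw [if_neg (by omega)])
    (fun i => by unfold nuFun; split_ifs <;> omega)
  obtain ⟨T, hT⟩ := lr_exists k (n - k) lam mu (nuFun n k lam mu) (conj lam)
    (fun j => conj mu (n - k - 1 - j)) hmu.2.2 hA hlam.2.2
    (fun i j _ => hB i _) hab (fun i => by convert hnu i)
  unfold lrCoeff
  rw [Nat.one_le_iff_ne_zero, ← Nat.pos_iff_ne_zero, Set.ncard_pos hfin]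
  exact ⟨T, hT⟩
end

section
/- Let 0 < k < n be integers and let λ and μ be partitions fitting in the k×(n−k) rectangle such that λ_i + μ_{k+1−i} ≤ n−k for all 1 ≤ i ≤ k. Let ρ = ρ(λ,μ) be the partition obtained by sorting the numbers k − λ'_j − μ'_{n−k+1−j} (for j = 1, …, n−k) into weakly decreasing order, and set ν(λ,μ) = (ρ')^∨. Then there is at most one Littlewood–Richardson filling of the skew shape ν(λ,μ)/λ of content μ; that is, c_{λμ}^{ν(λ,μ)} ≤ 1. -/
open Finset in
theorem lt_conj_iff {k r : ℕ} {p : ℕ → ℕ} (hp : IsRectPartition k r p) (i j : ℕ) :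
    i < conj p j ↔ j < p i := by
  have hanti : Antitone p := antitone_nat_of_succ_le hp.1
  have hfin : {i : ℕ | j < p i}.Finite := by
    refine (Set.finite_Iio k).subset ?_
    intro x hx
    simp only [Set.mem_ofPred_eq] at hx
    by_contra h
    have := hp.2.1 x (by simpa using h)
    omega
  unfold conj
  constructor
  · intro h
    by_contra hc
    have hsub : {i : ℕ | j < p i} ⊆ ((Finset.range i : Finset ℕ) : Set ℕ) := by
      intro x hx
      simp only [Set.mem_ofPred_eq] at hx
      simp only [Finset.coe_range, Set.mem_Iio]
      by_contra h2
      have := hanti (not_lt.mp h2)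
      omega
    have := Set.ncard_le_ncard hsub (Finset.finite_toSet _)
    rw [Set.ncard_coe_finset, Finset.card_range] at this
    omega
  · intro h
    have hsub : ((Finset.range (i+1) : Finset ℕ) : Set ℕ) ⊆ {i : ℕ | j < p i} := by
      intro x hx
      simp only [Finset.coe_range, Set.mem_Iio] at hx
      simp only [Set.mem_ofPred_eq]
      have := hanti (Nat.lt_succ_iff.mp hx)
      omega
    have := Set.ncard_le_ncard hsub hfin
    rw [Set.ncard_coe_finset, Finset.card_range] at this
    omega

theorem finite_getD (m : ℕ) (L : List ℕ) : {i : ℕ | m < L.getD i 0}.Finite := by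
  refine (Set.finite_Iio L.length).subset ?_
  intro x hx
  simp only [Set.mem_ofPred_eq] at hx
  by_contra h
  rw [List.getD_eq_default _ _ (by simpa using h)] at hx
  omega

theorem ncard_getD (m : ℕ) (L : List ℕ) :
    Set.ncard {i : ℕ | m < L.getD i 0} = L.countP (fun x => decide (m < x)) := by
  induction L with
  | nil => simp
  | cons a L ih =>
    have himg : (Nat.succ '' {i : ℕ | m < L.getD i 0}).ncard
        = L.countP (fun x => decide (m < x)) := by
      rw [Set.ncard_image_of_injective _ Nat.succ_injective, ih]
    rw [List.countP_cons]
    by_cases ha : m < a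
    · have : {i : ℕ | m < (a :: L).getD i 0} = insert 0 (Nat.succ '' {i : ℕ | m < L.getD i 0}) := by
        ext x
        cases x <;> simp [ha]
      rw [this, Set.ncard_insert_of_notMem (by simp) ((finite_getD m L).image _), himg]
      simp [ha]
    · have : {i : ℕ | m < (a :: L).getD i 0} = (Nat.succ '' {i : ℕ | m < L.getD i 0}) := by
        ext x
        cases x <;> simp [ha]
      rw [this, himg]
      simp [ha]

theorem countP_range_eq (P : ℕ → Prop) [DecidablePred P] (r : ℕ) :
    (List.range r).countP (fun x => decide (P x)) = ∑ j ∈ Finset.range r, if P j then 1 else 0 := by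
  induction r with
  | zero => simp
  | succ r ih => rw [List.range_succ, List.countP_append, Finset.sum_range_succ, ih]; simp

theorem nuFun_eq (n k : ℕ) (lam mu : ℕ → ℕ) (i : ℕ) (hi : i < k) :
    nuFun n k lam mu i = ∑ j ∈ Finset.range (n - k),
      if i < conj lam j + conj mu (n - k - 1 - j) then 1 else 0 := by
  have h1 : conj (rhoFun n k lam mu) (k - 1 - i) = ∑ j ∈ Finset.range (n - k),
      if (k - 1 - i < k - conj lam j - conj mu (n - k - 1 - j)) then 1 else 0 := by
    unfold conj rhoFun
    rw [ncard_getD, (List.perm_insertionSort _ _).countP_eq, List.countP_map,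
      ← countP_range_eq]
    rfl
  have h2 : (∑ j ∈ Finset.range (n - k),
      if i < conj lam j + conj mu (n - k - 1 - j) then 1 else 0) +
      (∑ j ∈ Finset.range (n - k),
      if (k - 1 - i < k - conj lam j - conj mu (n - k - 1 - j)) then 1 else 0) = n - k := by
    rw [← Finset.sum_add_distrib]
    rw [Finset.sum_congr rfl (g := fun _ => 1)]
    · simp
    · intro j _
      split_ifs <;> omega
  unfold nuFun
  rw [if_pos hi, h1]
  omega

theorem sum_ind_min (i a : ℕ) :
    (∑ x ∈ Finset.range i, if x < a then 1 else 0) = min i a := by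
  induction i with
  | zero => simp
  | succ i ih => rw [Finset.sum_range_succ, ih]; split_ifs <;> omega

theorem numeric_identity (n k : ℕ) (lam mu : ℕ → ℕ)
    (hlam : IsRectPartition k (n - k) lam) (hmu : IsRectPartition k (n - k) mu)
    (i : ℕ) (hi : i ≤ k) :
    ∑ x ∈ Finset.range i, nuFun n k lam mu x =
      ∑ x ∈ Finset.range i, lam x +
      ∑ e ∈ Finset.range i, min (mu e) (n - k - lam (i - 1 - e)) := by
  have hA : ∑ x ∈ Finset.range i, nuFun n k lam mu x = ∑ j ∈ Finset.range (n - k),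
      min i (conj lam j + conj mu (n - k - 1 - j)) := by
    rw [Finset.sum_congr rfl (fun x hx => nuFun_eq n k lam mu x
      (lt_of_lt_of_le (Finset.mem_range.mp hx) hi)), Finset.sum_comm]
    exact Finset.sum_congr rfl (fun j _ => sum_ind_min _ _)
  have hB : ∑ x ∈ Finset.range i, lam x = ∑ j ∈ Finset.range (n - k), min i (conj lam j) := by
    rw [← Finset.sum_congr rfl (fun j _ => sum_ind_min i (conj lam j)), Finset.sum_comm]
    refine Finset.sum_congr rfl (fun x _ => ?_)
    simp only [lt_conj_iff hlam]
    rw [sum_ind_min, min_eq_right (hlam.2.2 x)]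
  have hC : ∑ e ∈ Finset.range i, min (mu e) (n - k - lam (i - 1 - e)) =
      ∑ j ∈ Finset.range (n - k), min i (min (conj mu (n - k - 1 - j)) (i - conj lam j)) := by
    rw [← Finset.sum_congr rfl (fun j _ => sum_ind_min i _), Finset.sum_comm]
    refine Finset.sum_congr rfl (fun e he => ?_)
    have he' := Finset.mem_range.mp he
    have h1 : ∀ j ∈ Finset.range (n-k),
        (if e < min (conj mu (n - k - 1 - j)) (i - conj lam j) then 1 else 0) =
        (if (n - k - 1 - j) < min (mu e) (n - k - lam (i - 1 - e)) then 1 else 0) := by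
      intro j hj
      have hj' := Finset.mem_range.mp hj
      have a1 := lt_conj_iff hmu e (n - k - 1 - j)
      have a2 := lt_conj_iff hlam (i - 1 - e) j
      have := hlam.2.2 (i - 1 - e)
      congr 1
      simp only [eq_iff_iff, lt_min_iff, a1]
      constructor
      · rintro ⟨b1, b2⟩
        refine ⟨b1, ?_⟩
        have : ¬ (i - 1 - e < conj lam j) := by omega
        rw [a2] at this
        omega
      · rintro ⟨b1, b2⟩
        refine ⟨b1, ?_⟩
        have : ¬ (j < lam (i - 1 - e)) := by omega
        rw [← a2] at this
        omega
    rw [Finset.sum_congr rfl h1, Finset.sum_range_reflect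
      (fun c => if c < min (mu e) (n - k - lam (i - 1 - e)) then 1 else 0), sum_ind_min]
    omega
  rw [hA, hB, hC, ← Finset.sum_add_distrib]
  exact Finset.sum_congr rfl (fun j _ => by omega)

/-- number of entries `e+1` in the rows `< i`. -/
def cnt (k r : ℕ) (T : ℕ → ℕ → ℕ) (i e : ℕ) : ℕ :=
  ((Finset.range k ×ˢ Finset.range r).filter (fun p => p.1 < i ∧ T p.1 p.2 = e + 1)).card

section fill
variable {k r : ℕ} {lam mu nu : ℕ → ℕ} {T : ℕ → ℕ → ℕ}

theorem skew_mem (hnu0 : ∀ i, k ≤ i → nu i = 0) (hnur : ∀ i, nu i ≤ r) {i j : ℕ}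
    (h : InSkew lam nu i j) : i < k ∧ j < r := by
  obtain ⟨h1, h2⟩ := h
  refine ⟨?_, lt_of_lt_of_le h2 (hnur i)⟩
  by_contra hc
  rw [hnu0 i (by omega)] at h2
  omega

theorem skew_of_pos (hT : IsLRFilling lam mu nu T) {i j e : ℕ} (h : T i j = e + 1) :
    InSkew lam nu i j := by
  by_contra hc
  rw [hT.1 i j hc] at h
  omega

theorem cnt_le_mu (hnu0 : ∀ i, k ≤ i → nu i = 0) (hnur : ∀ i, nu i ≤ r)
    (hT : IsLRFilling lam mu nu T) (i e : ℕ) : cnt k r T i e ≤ mu e := by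
  rw [← hT.2.2.2.2.2 e]
  unfold cnt
  rw [← Set.ncard_coe_finset]
  apply Set.ncard_le_ncard
  · intro p hp
    simp only [Finset.coe_filter, Set.mem_ofPred_eq] at hp
    exact ⟨skew_of_pos hT hp.2.2, hp.2.2⟩
  · refine (Finset.finite_toSet (Finset.range k ×ˢ Finset.range r)).subset ?_
    rintro p ⟨hp, _⟩
    simpa using skew_mem hnu0 hnur hp

theorem cnt_succ_le (hnu0 : ∀ i, k ≤ i → nu i = 0) (hnur : ∀ i, nu i ≤ r)
    (hT : IsLRFilling lam mu nu T) (i e : ℕ) : cnt k r T (i+1) (e+1) ≤ cnt k r T i e := by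
  classical
  have hex : ∃ c, ∀ j, c ≤ j → InSkew lam nu i j → e + 2 ≤ T i j := by
    refine ⟨r, fun j hj hs => ?_⟩
    have := (skew_mem hnu0 hnur hs).2
    omega
  obtain ⟨c, hc, hmin⟩ : ∃ c, (∀ j, c ≤ j → InSkew lam nu i j → e + 2 ≤ T i j) ∧
      ∀ j, j < c → InSkew lam nu i j → T i j < e + 2 := by
    refine ⟨Nat.find hex, Nat.find_spec hex, fun j hj hs => ?_⟩
    have := Nat.find_min hex hj
    push Not at this
    obtain ⟨j', h1, h2, h3⟩ := this
    exact lt_of_le_of_lt (hT.2.2.1 i j j' hs h2 h1) h3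
  have hY := hT.2.2.2.2.1 i c (e+1) (by omega)
  have h1 : cnt k r T (i+1) (e+1) ≤ Set.ncard {p : ℕ × ℕ | InSkew lam nu p.1 p.2 ∧
        (p.1 < i ∨ (p.1 = i ∧ c ≤ p.2)) ∧ T p.1 p.2 = e + 1 + 1} := by
    unfold cnt
    rw [← Set.ncard_coe_finset]
    apply Set.ncard_le_ncard
    · rintro ⟨a, b⟩ hp
      simp only [Finset.coe_filter, Set.mem_ofPred_eq] at hp
      have hs := skew_of_pos hT hp.2.2
      refine ⟨hs, ?_, hp.2.2⟩
      rcases Nat.lt_or_ge a i with h | h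
      · exact Or.inl h
      · have : a = i := by omega
        subst this
        refine Or.inr ⟨rfl, ?_⟩
        by_contra hcon
        have := hmin b (by simpa using hcon) hs
        omega
    · refine (Finset.finite_toSet (Finset.range k ×ˢ Finset.range r)).subset ?_
      rintro p ⟨hp, _⟩
      simpa using skew_mem hnu0 hnur hp
  have h2 : Set.ncard {p : ℕ × ℕ | InSkew lam nu p.1 p.2 ∧
        (p.1 < i ∨ (p.1 = i ∧ c ≤ p.2)) ∧ T p.1 p.2 = e + 1} ≤ cnt k r T i e := by
    unfold cnt
    rw [← Set.ncard_coe_finset]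
    apply Set.ncard_le_ncard
    · rintro ⟨a, b⟩ ⟨hs, hor, hv⟩
      have := skew_mem hnu0 hnur hs
      simp only [Finset.coe_filter, Set.mem_ofPred_eq, Finset.mem_product, Finset.mem_range]
      refine ⟨this, ?_, hv⟩
      rcases hor with h | ⟨h, h'⟩
      · exact h
      · simp only at h h' hs hv
        subst h
        have := hc b h' hs
        omega
    · exact Finset.finite_toSet _
  omega

theorem cnt_eq_zero (hnu0 : ∀ i, k ≤ i → nu i = 0) (hnur : ∀ i, nu i ≤ r)
    (hT : IsLRFilling lam mu nu T) (i : ℕ) : ∀ e, i ≤ e → cnt k r T i e = 0 := by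
  induction i with
  | zero => intro e _; simp [cnt]
  | succ i ih =>
    intro e he
    obtain ⟨e, rfl⟩ : ∃ e', e = e' + 1 := ⟨e - 1, by omega⟩
    have := cnt_succ_le hnu0 hnur hT i e
    rw [ih e (by omega)] at this
    omega

theorem cnt_zero_le (hlam : IsRectPartition k r lam)
    (hT : IsLRFilling lam mu nu T) (i : ℕ) : cnt k r T (i+1) 0 ≤ r - lam i := by
  have hanti : Antitone lam := antitone_nat_of_succ_le hlam.1
  rw [← Nat.card_Ico]
  unfold cnt
  refine Finset.card_le_card_of_injOn Prod.snd ?_ ?_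
  · rintro ⟨a, b⟩ hp
    simp only [Finset.coe_filter, Set.mem_ofPred_eq, Finset.mem_product, Finset.mem_range] at hp
    have hs := skew_of_pos hT hp.2.2
    have := hanti (Nat.lt_succ_iff.mp hp.2.1)
    have := hs.1
    simp only [Finset.coe_Ico, Set.mem_Ico]
    omega
  · rintro ⟨a, b⟩ hp ⟨a', b'⟩ hp' hbb
    simp only [Finset.coe_filter, Set.mem_ofPred_eq, Finset.mem_product, Finset.mem_range] at hp hp'
    simp only at hbb
    subst hbb
    have hs := skew_of_pos hT hp.2.2
    have hs' := skew_of_pos hT hp'.2.2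
    rcases lt_trichotomy a a' with h | h | h
    · have := hT.2.2.2.1 a a' b h hs hs'
      omega
    · rw [h]
    · have := hT.2.2.2.1 a' a b h hs' hs
      omega

theorem cnt_le_lam (hlam : IsRectPartition k r lam)
    (hnu0 : ∀ i, k ≤ i → nu i = 0) (hnur : ∀ i, nu i ≤ r)
    (hT : IsLRFilling lam mu nu T) (e : ℕ) :
    ∀ i, e < i → cnt k r T i e ≤ r - lam (i - 1 - e) := by
  induction e with
  | zero =>
    intro i hi
    obtain ⟨i, rfl⟩ : ∃ e', i = e' + 1 := ⟨i - 1, by omega⟩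
    simpa using cnt_zero_le hlam hT i
  | succ e ih =>
    intro i hi
    obtain ⟨i, rfl⟩ : ∃ e', i = e' + 1 := ⟨i - 1, by omega⟩
    have h1 := ih i (by omega)
    have h2 := cnt_succ_le hnu0 hnur hT i e
    have : i + 1 - 1 - (e + 1) = i - 1 - e := by omega
    rw [this]
    omega

theorem sum_cnt (i v : ℕ) : ∑ e ∈ Finset.range v, cnt k r T i e =
    ((Finset.range k ×ˢ Finset.range r).filter
      (fun p => p.1 < i ∧ 1 ≤ T p.1 p.2 ∧ T p.1 p.2 ≤ v)).card := by
  rw [Finset.card_eq_sum_card_fiberwise (f := fun p => T p.1 p.2 - 1) (t := Finset.range v)]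
  · refine Finset.sum_congr rfl (fun e he => ?_)
    have := Finset.mem_range.mp he
    unfold cnt
    congr 1
    ext ⟨a, b⟩
    simp only [Finset.mem_filter]
    constructor
    · rintro ⟨h1, h2, h3⟩
      exact ⟨⟨h1, h2, by omega, by omega⟩, by omega⟩
    · rintro ⟨⟨h1, h2, h3, h4⟩, h5⟩
      exact ⟨h1, h2, by omega⟩
  · rintro ⟨a, b⟩ hp
    simp only [Finset.coe_filter, Set.mem_ofPred_eq] at hp
    simp only [Finset.coe_range, Set.mem_Iio]
    omega

theorem sum_cnt_row (i v : ℕ) (hi : i < k) : ∑ e ∈ Finset.range v, cnt k r T (i+1) e =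
    ∑ e ∈ Finset.range v, cnt k r T i e +
    ((Finset.range r).filter (fun j => 1 ≤ T i j ∧ T i j ≤ v)).card := by
  classical
  rw [sum_cnt, sum_cnt]
  have : ((Finset.range r).filter (fun j => 1 ≤ T i j ∧ T i j ≤ v)).card =
    (((Finset.range r).filter (fun j => 1 ≤ T i j ∧ T i j ≤ v)).image (fun j => (i, j))).card := by
    rw [Finset.card_image_of_injective]
    intro a b h
    simpa using h
  rw [this, ← Finset.card_union_of_disjoint]
  · congr 1
    ext ⟨a, b⟩
    simp only [Finset.mem_filter, Finset.mem_union, Finset.mem_image, Finset.mem_product,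
      Finset.mem_range, Prod.mk.injEq]
    constructor
    · rintro ⟨h1, h2, h3⟩
      rcases Nat.lt_or_ge a i with h | h
      · exact Or.inl ⟨h1, h, h3⟩
      · have : a = i := by omega
        subst this
        exact Or.inr ⟨b, ⟨h1.2, h3⟩, rfl, rfl⟩
    · rintro (⟨h1, h2, h3⟩ | ⟨j, ⟨h1, h2⟩, rfl, rfl⟩)
      · exact ⟨h1, by omega, h3⟩
      · exact ⟨⟨hi, h1⟩, by omega, h2⟩
  · rw [Finset.disjoint_left]
    rintro ⟨a, b⟩ h1 h2
    simp only [Finset.mem_filter, Finset.mem_image, Prod.mk.injEq] at h1 h2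
    obtain ⟨j, _, rfl, _⟩ := h2
    omega

theorem sum_cnt_total (hnu0 : ∀ i, k ≤ i → nu i = 0) (hnur : ∀ i, nu i ≤ r)
    (hT : IsLRFilling lam mu nu T) (i : ℕ) (hi : i ≤ k) :
    ∑ e ∈ Finset.range i, cnt k r T i e = ∑ x ∈ Finset.range i, (nu x - lam x) := by
  -- the bound on the values can be replaced by any larger one
  have hext : ∀ m v, m ≤ v →
      ∑ e ∈ Finset.range v, cnt k r T m e = ∑ e ∈ Finset.range m, cnt k r T m e := by
    intro m v hv
    symm
    refine Finset.sum_subset (by simpa using hv) ?_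
    intro x _ hx
    exact cnt_eq_zero hnu0 hnur hT m x (by simpa using hx)
  induction i with
  | zero => simp
  | succ i ih =>
    rw [sum_cnt_row i (i+1) (by omega), hext i (i+1) (by omega), ih (by omega),
      Finset.sum_range_succ]
    congr 1
    rw [← Nat.card_Ico]
    congr 1
    ext j
    simp only [Finset.mem_filter, Finset.mem_range, Finset.mem_Ico]
    constructor
    · rintro ⟨h1, h2, h3⟩
      exact skew_of_pos hT (e := T i j - 1) (by omega)
    · intro hs
      have hm := skew_mem (lam := lam) hnu0 hnur hs
      have h1 := hT.2.1 i j hs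
      refine ⟨hm.2, h1, ?_⟩
      by_contra hc
      have h0 := cnt_eq_zero hnu0 hnur hT (i+1) (T i j - 1) (by omega)
      unfold cnt at h0
      rw [Finset.card_eq_zero] at h0
      have : (i, j) ∈ (∅ : Finset (ℕ × ℕ)) := by
        rw [← h0]
        simp only [Finset.mem_filter, Finset.mem_product, Finset.mem_range]
        exact ⟨hm, by omega, by omega⟩
      simp at this

theorem le_of_cnt_eq {T' : ℕ → ℕ → ℕ} (hnu0 : ∀ i, k ≤ i → nu i = 0) (hnur : ∀ i, nu i ≤ r)
    (hT : IsLRFilling lam mu nu T) (hT' : IsLRFilling lam mu nu T')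
    (h : ∀ i e, i ≤ k → cnt k r T i e = cnt k r T' i e) (i j : ℕ) : T' i j ≤ T i j := by
  by_cases hs : InSkew lam nu i j
  swap
  · rw [hT.1 i j hs, hT'.1 i j hs]
  by_contra hc
  push Not at hc
  have hm := skew_mem (lam := lam) hnu0 hnur hs
  have e1 := sum_cnt_row (r := r) (T := T) i (T i j) hm.1
  have e2 := sum_cnt_row (r := r) (T := T') i (T i j) hm.1
  have e3 : ∑ e ∈ Finset.range (T i j), cnt k r T (i+1) e =
      ∑ e ∈ Finset.range (T i j), cnt k r T' (i+1) e :=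
    Finset.sum_congr rfl (fun e _ => h (i+1) e hm.1)
  have e4 : ∑ e ∈ Finset.range (T i j), cnt k r T i e =
      ∑ e ∈ Finset.range (T i j), cnt k r T' i e :=
    Finset.sum_congr rfl (fun e _ => h i e (le_of_lt hm.1))
  have hcard : ((Finset.range r).filter (fun x => 1 ≤ T' i x ∧ T' i x ≤ T i j)).card <
      ((Finset.range r).filter (fun x => 1 ≤ T i x ∧ T i x ≤ T i j)).card := by
    have b1 : ((Finset.range r).filter (fun x => 1 ≤ T' i x ∧ T' i x ≤ T i j)) ⊆
        Finset.Ico (lam i) j := by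
      intro x hx
      simp only [Finset.mem_filter, Finset.mem_range] at hx
      have hsx := skew_of_pos hT' (i := i) (j := x) (e := T' i x - 1) (by omega)
      simp only [Finset.mem_Ico]
      refine ⟨hsx.1, ?_⟩
      by_contra hcon
      have := hT'.2.2.1 i j x hs hsx (by omega)
      omega
    have b2 : Finset.Ico (lam i) (j+1) ⊆
        ((Finset.range r).filter (fun x => 1 ≤ T i x ∧ T i x ≤ T i j)) := by
      intro x hx
      simp only [Finset.mem_Ico] at hx
      have hsx : InSkew lam nu i x := ⟨hx.1, lt_of_le_of_lt (by omega) hs.2⟩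
      simp only [Finset.mem_filter, Finset.mem_range]
      exact ⟨by omega, hT.2.1 i x hsx, hT.2.2.1 i x j hsx hs (by omega)⟩
    have c1 := Finset.card_le_card b1
    have c2 := Finset.card_le_card b2
    rw [Nat.card_Ico] at c1 c2
    have := hs.1
    omega
  omega

end fill

theorem nuFun_zero (n k : ℕ) (lam mu : ℕ → ℕ) (i : ℕ) (hi : k ≤ i) : nuFun n k lam mu i = 0 := by
  unfold nuFun
  rw [if_neg (by omega)]

theorem nuFun_le (n k : ℕ) (lam mu : ℕ → ℕ) (i : ℕ) : nuFun n k lam mu i ≤ n - k := by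
  unfold nuFun
  split_ifs <;> omega

theorem lam_le_nuFun (n k : ℕ) (lam mu : ℕ → ℕ)
    (hlam : IsRectPartition k (n - k) lam) (i : ℕ) (hi : i < k) : lam i ≤ nuFun n k lam mu i := by
  rw [nuFun_eq n k lam mu i hi, ← min_eq_right (hlam.2.2 i), ← sum_ind_min]
  refine Finset.sum_le_sum (fun j _ => ?_)
  have := lt_conj_iff hlam i j
  simp only [← this]
  split_ifs <;> omega

theorem cnt_eq_min (n k : ℕ) (lam mu : ℕ → ℕ)
    (hlam : IsRectPartition k (n - k) lam) (hmu : IsRectPartition k (n - k) mu)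
    (T : ℕ → ℕ → ℕ) (hT : IsLRFilling lam mu (nuFun n k lam mu) T) (i e : ℕ) (hi : i ≤ k)
    (he : e < i) : cnt k (n - k) T i e = min (mu e) (n - k - lam (i - 1 - e)) := by
  have h0 := nuFun_zero n k lam mu
  have hr := nuFun_le n k lam mu
  have hle : ∀ e ∈ Finset.range i,
      cnt k (n - k) T i e ≤ min (mu e) (n - k - lam (i - 1 - e)) := fun e he =>
    le_min (cnt_le_mu h0 hr hT i e) (cnt_le_lam hlam h0 hr hT e i (Finset.mem_range.mp he))
  refine (Finset.sum_eq_sum_iff_of_le hle).mp ?_ e (Finset.mem_range.mpr he)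
  rw [sum_cnt_total h0 hr hT i hi]
  have h1 := numeric_identity n k lam mu hlam hmu i hi
  have h2 : ∑ x ∈ Finset.range i, (nuFun n k lam mu x - lam x) + ∑ x ∈ Finset.range i, lam x
      = ∑ x ∈ Finset.range i, nuFun n k lam mu x := by
    rw [← Finset.sum_add_distrib]
    refine Finset.sum_congr rfl (fun x hx => ?_)
    have := lam_le_nuFun n k lam mu hlam x (lt_of_lt_of_le (Finset.mem_range.mp hx) hi)
    omega
  omega

/-- For `λ`, `μ` in the `k × (n−k)` rectangle with
`λ_i + μ_{k+1−i} ≤ n−k` for all `1 ≤ i ≤ k`, there is at most one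
Littlewood–Richardson filling of `ν(λ,μ)/λ` of content `μ`; that is,
`c_{λμ}^{ν(λ,μ)} ≤ 1`. -/
theorem lrCoeff_nuFun_le_one (n k : ℕ) (hk : 0 < k) (hkn : k < n)
    (lam mu : ℕ → ℕ)
    (hlam : IsRectPartition k (n - k) lam) (hmu : IsRectPartition k (n - k) mu)
    (hno : ∀ i, i < k → lam i + mu (k - 1 - i) ≤ n - k) :
    lrCoeff lam mu (nuFun n k lam mu) ≤ 1 := by
  have h0 := nuFun_zero n k lam mu
  have hr := nuFun_le n k lam mu
  have hsub : {T : ℕ → ℕ → ℕ | IsLRFilling lam mu (nuFun n k lam mu) T}.Subsingleton := by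
    intro T hT T' hT'
    simp only [Set.mem_ofPred_eq] at hT hT'
    have h : ∀ i e, i ≤ k → cnt k (n - k) T i e = cnt k (n - k) T' i e := by
      intro i e hi
      rcases Nat.lt_or_ge e i with he | he
      · rw [cnt_eq_min n k lam mu hlam hmu T hT i e hi he,
          cnt_eq_min n k lam mu hlam hmu T' hT' i e hi he]
      · rw [cnt_eq_zero h0 hr hT i e he, cnt_eq_zero h0 hr hT' i e he]
    funext i j
    exact le_antisymm
      (le_of_cnt_eq h0 hr hT' hT (fun i e hi => (h i e hi).symm) i j)
      (le_of_cnt_eq h0 hr hT hT' h i j)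
  have := hsub.finite.to_subtype
  exact Set.ncard_le_one_iff_subsingleton.mpr hsub
end

section
/- Let 0 < k < n be integers and let μ be a partition fitting in the k×(n−k) rectangle. Let R = ((n−k), (n−k), …, (n−k)) (k parts) be the full rectangle partition and let μ^∨ = (n−k−μ_k, …, n−k−μ_1) be the complement of μ in the rectangle. Then the Littlewood–Richardson number c_{μ^∨, μ}^{R} equals 1. -/
theorem lr_exists_height (k r : ℕ) (mu : ℕ → ℕ) (hmu : IsRectPartition k r mu) :
    ∃ h : ℕ → ℕ, ∀ j, j < r → ∀ t, t < h j ↔ r - j ≤ mu t := by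
  have key : ∀ j, ∃ a, j < r → ∀ t, t < a ↔ r - j ≤ mu t := by
    intro j
    by_cases hj : j < r
    · have hex : ∃ t, ¬ (r - j ≤ mu t) := ⟨k, by rw [hmu.2.1 k le_rfl]; omega⟩
      classical
      refine ⟨Nat.find hex, fun _ t => ⟨fun ht => ?_, fun ht => ?_⟩⟩
      · exact not_not.mp (Nat.find_min hex ht)
      · by_contra hlt
        have h1 := Nat.find_spec hex
        have hanti : Antitone mu := antitone_nat_of_succ_le hmu.1
        have h2 := hanti (not_lt.mp hlt)
        omega
    · exact ⟨0, fun h => absurd h hj⟩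
  choose h hh using key
  exact ⟨h, hh⟩

theorem lr_aux (k r : ℕ) (mu lam nu h : ℕ → ℕ) (hmu : IsRectPartition k r mu)
    (hh : ∀ j, j < r → ∀ t, t < h j ↔ r - j ≤ mu t)
    (hS : ∀ i j, InSkew lam nu i j ↔ (i < k ∧ j < r ∧ k - 1 - i < h j)) :
    lrCoeff lam mu nu = 1 := by
  classical
  have hhk : ∀ j, j < r → h j ≤ k := by
    intro j hj
    by_contra hc
    have := (hh j hj k).1 (by omega)
    rw [hmu.2.1 k le_rfl] at this
    omega
  let T0 : ℕ → ℕ → ℕ := fun i j => if InSkew lam nu i j then h j + i + 1 - k else 0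
  have hT0 : ∀ i j, InSkew lam nu i j → T0 i j = h j + i + 1 - k := by
    intro i j hij
    simp only [T0, if_pos hij]
  let S : Finset (ℕ × ℕ) := (Finset.range k ×ˢ Finset.range r).filter
    (fun p => InSkew lam nu p.1 p.2)
  have hmemS : ∀ p, p ∈ S ↔ InSkew lam nu p.1 p.2 := by
    intro p
    simp only [S, Finset.mem_filter, Finset.mem_product, Finset.mem_range]
    constructor
    · exact fun hp => hp.2
    · intro hp
      have := (hS _ _).1 hp
      exact ⟨⟨this.1, this.2.1⟩, hp⟩
  have hcont : ∀ e, Set.ncard {p : ℕ × ℕ | InSkew lam nu p.1 p.2 ∧ T0 p.1 p.2 = e + 1} = mu e := by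
    intro e
    have himg : {p : ℕ × ℕ | InSkew lam nu p.1 p.2 ∧ T0 p.1 p.2 = e + 1} =
        (((Finset.Ico (r - mu e) r).image (fun j => (k + e - h j, j)) : Finset (ℕ × ℕ)) :
          Set (ℕ × ℕ)) := by
      ext ⟨i, j⟩
      simp only [Set.mem_setOf_eq, Finset.coe_image, Set.mem_image, Finset.mem_coe,
        Finset.mem_Ico, Prod.mk.injEq]
      constructor
      · rintro ⟨hij, hv⟩
        rw [hT0 i j hij] at hv
        obtain ⟨h1, h2, h3⟩ := (hS i j).1 hij
        have h4 := hhk j h2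
        have h5 := (hh j h2 e).1 (by omega)
        exact ⟨j, by omega, by omega, rfl⟩
      · rintro ⟨j', ⟨h1, h2⟩, h3, rfl⟩
        have h4 := hhk j' h2
        have h5 := (hh j' h2 e).2 (by omega)
        have hij : InSkew lam nu i j' := (hS i j').2 ⟨by omega, h2, by omega⟩
        refine ⟨hij, ?_⟩
        rw [hT0 i j' hij]
        omega
    rw [himg, Set.ncard_coe_finset, Finset.card_image_of_injective]
    · have := hmu.2.2 e
      simp only [Nat.card_Ico]
      omega
    · intro a b hab
      exact (Prod.mk.inj hab).2
  have hLR0 : IsLRFilling lam mu nu T0 := by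
    refine ⟨?_, ?_, ?_, ?_, ?_, hcont⟩
    · intro i j hij
      simp only [T0, if_neg hij]
    · intro i j hij
      rw [hT0 i j hij]
      have := (hS i j).1 hij
      omega
    · intro i j1 j2 h1 h2 hle
      rw [hT0 i j1 h1, hT0 i j2 h2]
      have a1 := (hS i j1).1 h1
      have a2 := (hS i j2).1 h2
      have : h j1 ≤ h j2 := by
        by_contra hc
        have b1 := (hh j1 a1.2.1 (h j2)).1 (by omega)
        have b2 := (hh j2 a2.2.1 (h j2)).2 (by omega)
        omega
      omega
    · intro i1 i2 j hlt h1 h2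
      rw [hT0 i1 j h1, hT0 i2 j h2]
      have a1 := (hS i1 j).1 h1
      omega
    · intro m c e he
      refine Set.ncard_le_ncard_of_injOn (fun p => (p.1 - 1, p.2)) ?_ ?_ ?_
      · rintro ⟨i, j⟩ ⟨hij, hpre, hv⟩
        simp only at hij hpre hv
        rw [hT0 i j hij] at hv
        have a := (hS i j).1 hij
        have a' := hhk j a.2.1
        have hij' : InSkew lam nu (i - 1) j := (hS _ _).2 ⟨by omega, a.2.1, by omega⟩
        refine ⟨hij', ?_, ?_⟩
        · simp only
          omega
        · simp only
          rw [hT0 _ _ hij']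
          omega
      · rintro ⟨i, j⟩ ⟨hij, hpre, hv⟩ ⟨i', j'⟩ ⟨hij', hpre', hv'⟩ heq
        simp only at hij hpre hv hij' hpre' hv'
        simp only [Prod.mk.injEq] at heq
        obtain ⟨h1, rfl⟩ := heq
        rw [hT0 i j hij] at hv
        rw [hT0 i' j hij'] at hv'
        simp only [Prod.mk.injEq, and_true]
        omega
      · exact S.finite_toSet.subset (fun p hp => (hmemS p).2 hp.1)
  have huniq : ∀ T, IsLRFilling lam mu nu T → T = T0 := by
    rintro T ⟨hz, hpos, hrow, hcol, -, hc⟩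
    have hle : ∀ i j, InSkew lam nu i j → T0 i j ≤ T i j := by
      intro i
      induction i with
      | zero =>
        intro j hij
        have a := (hS _ _).1 hij
        have a' := hhk j a.2.1
        have := hpos _ _ hij
        rw [hT0 _ _ hij]
        omega
      | succ i ih =>
        intro j hij
        have a := (hS _ _).1 hij
        have a' := hhk j a.2.1
        have := hpos _ _ hij
        by_cases hij' : InSkew lam nu i j
        · have b := ih j hij'
          have b2 := hcol i (i + 1) j (by omega) hij' hij
          rw [hT0 _ _ hij'] at b
          rw [hT0 _ _ hij]
          omega
        · rw [hS] at hij'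
          rw [hT0 _ _ hij]
          omega
    have hcnt : ∀ (U : ℕ → ℕ → ℕ), (∀ i j, InSkew lam nu i j → 1 ≤ U i j) →
        (∀ e, Set.ncard {p : ℕ × ℕ | InSkew lam nu p.1 p.2 ∧ U p.1 p.2 = e + 1} = mu e) →
        ∀ v, (S.val.map (fun p => U p.1 p.2)).count v = if v = 0 then 0 else mu (v - 1) := by
      intro U hU1 hU2 v
      have h0 : (S.val.map (fun p => U p.1 p.2)).count v =
          (S.filter (fun p => v = U p.1 p.2)).card := by
        rw [Multiset.count_map]
        rfl
      rw [h0]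
      split_ifs with hv
      · rw [Finset.card_eq_zero, Finset.filter_eq_empty_iff]
        intro p hp
        have := hU1 _ _ ((hmemS p).1 hp)
        omega
      · rw [← hU2 (v - 1), ← Set.ncard_coe_finset]
        congr 1
        ext p
        simp only [Finset.coe_filter, Set.mem_setOf_eq, hmemS]
        constructor
        · rintro ⟨x, y⟩
          exact ⟨x, by omega⟩
        · rintro ⟨x, y⟩
          exact ⟨x, by omega⟩
    have hms : S.val.map (fun p => T0 p.1 p.2) = S.val.map (fun p => T p.1 p.2) := by
      ext v
      rw [hcnt T0 hLR0.2.1 hcont, hcnt T hpos hc]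
    have hsum : ∑ p ∈ S, T0 p.1 p.2 = ∑ p ∈ S, T p.1 p.2 := congrArg Multiset.sum hms
    have heq := (Finset.sum_eq_sum_iff_of_le
      (fun p hp => hle p.1 p.2 ((hmemS p).1 hp))).1 hsum
    funext i j
    by_cases hij : InSkew lam nu i j
    · exact (heq (i, j) ((hmemS (i, j)).2 hij)).symm
    · rw [hz i j hij, hLR0.1 i j hij]
  unfold lrCoeff
  rw [Set.ncard_eq_one]
  refine ⟨T0, ?_⟩
  ext T
  simp only [Set.mem_setOf_eq, Set.mem_singleton_iff]
  exact ⟨huniq T, fun hT => hT ▸ hLR0⟩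

/-- For `μ` in the `k × (n−k)` rectangle, with `R` the full
rectangle partition (`k` parts equal to `n−k`) and `μ^∨ = (n−k−μ_k, …, n−k−μ_1)`
the complement of `μ`, one has `c_{μ^∨, μ}^{R} = 1`. -/
theorem lrCoeff_complement_rectangle (n k : ℕ) (hk : 0 < k) (hkn : k < n)
    (mu : ℕ → ℕ) (hmu : IsRectPartition k (n - k) mu) :
    lrCoeff (fun i => if i < k then (n - k) - mu (k - 1 - i) else 0) mu
      (fun i => if i < k then n - k else 0) = 1 := by
  obtain ⟨h, hh⟩ := lr_exists_height k (n - k) mu hmu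
  refine lr_aux k (n - k) mu _ _ h hmu hh ?_
  intro i j
  unfold InSkew
  by_cases hi : i < k
  · simp only [if_pos hi]
    constructor
    · rintro ⟨h1, h2⟩
      exact ⟨hi, h2, (hh j h2 _).2 (by omega)⟩
    · rintro ⟨_, h2, h3⟩
      have := (hh j h2 _).1 h3
      exact ⟨by omega, h2⟩
  · simp only [if_neg hi]
    constructor
    · rintro ⟨_, h2⟩
      omega
    · rintro ⟨h1, _⟩
      exact absurd h1 hi
end

section
/- Let 0 < k < n be integers and let λ and μ be partitions fitting in the k×(n−k) rectangle such that λ_i + μ_{k+1−i} ≤ n−k for all 1 ≤ i ≤ k. Let ρ(λ,μ) be the partition obtained by sorting the numbers k − λ'_j − μ'_{n−k+1−j} (for j = 1, …, n−k) into weakly decreasing order. Define λ̃ by λ̃'_j = λ'_j + 1 if λ'_j + μ'_{n−k+1−j} < k and λ̃'_j = λ'_j otherwise. Then ρ(λ̃,μ) is obtained from ρ(λ,μ) by decreasing every positive part by 1; equivalently, ρ(λ̃,μ)'_r = ρ(λ,μ)'_{r+1} for all r ≥ 1. -/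
/-- Let `λ`, `μ` fit in the `k × (n−k)` rectangle with
`λ_i + μ_{k+1−i} ≤ n−k` for all `1 ≤ i ≤ k`, and let `λ̃` be the partition in the
rectangle whose conjugate is `λ̃'_j = λ'_j + 1` if `λ'_j + μ'_{n−k+1−j} < k` and
`λ̃'_j = λ'_j` otherwise.  Then `ρ(λ̃,μ)` is obtained from `ρ(λ,μ)` by decreasing
every positive part by `1`; equivalently, `ρ(λ̃,μ)'_r = ρ(λ,μ)'_{r+1}` for all
`r ≥ 1` (expressed 0-indexed below). -/
theorem rhoFun_tilde (n k : ℕ) (hk : 0 < k) (hkn : k < n)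
    (lam mu : ℕ → ℕ)
    (hlam : IsRectPartition k (n - k) lam) (hmu : IsRectPartition k (n - k) mu)
    (hno : ∀ i, i < k → lam i + mu (k - 1 - i) ≤ n - k)
    (tlam : ℕ → ℕ) (htlam : IsRectPartition k (n - k) tlam)
    (htconj : ∀ j, j < n - k → conj tlam j =
      if conj lam j + conj mu (n - k - 1 - j) < k then conj lam j + 1 else conj lam j) :
    (∀ r, rhoFun n k tlam mu r = rhoFun n k lam mu r - 1) ∧
      (∀ r, conj (rhoFun n k tlam mu) r = conj (rhoFun n k lam mu) (r + 1)) := by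
  have hlist : ((List.range (n - k)).map fun j => k - conj tlam j - conj mu (n - k - 1 - j)) =
      ((List.range (n - k)).map fun j => k - conj lam j - conj mu (n - k - 1 - j)).map
        (fun x => x - 1) := by
    rw [List.map_map]
    apply List.map_congr_left
    intro j hj
    rw [List.mem_range] at hj
    simp only [Function.comp]
    rw [htconj j hj]
    split_ifs <;> omega
  have h1 : ∀ r, rhoFun n k tlam mu r = rhoFun n k lam mu r - 1 := by
    intro r
    unfold rhoFun
    rw [hlist]
    generalize ((List.range (n - k)).map fun j => k - conj lam j - conj mu (n - k - 1 - j)) = L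
    have hs : List.insertionSort (· ≥ ·) (L.map (fun x => x - 1)) =
        (List.insertionSort (· ≥ ·) L).map (fun x => x - 1) := by
      apply List.Perm.eq_of_pairwise (le := (· ≥ ·))
      · intro a b _ _ h h'
        exact le_antisymm h' h
      · exact List.pairwise_insertionSort _ _
      · exact (List.pairwise_insertionSort (· ≥ ·) L).map _
          (fun a b h => Nat.sub_le_sub_right h 1)
      · exact (List.perm_insertionSort _ _).trans
          ((List.perm_insertionSort (· ≥ ·) L).symm.map _)
    rw [hs]
    simp only [List.getD_eq_getElem?_getD, List.getElem?_map]
    cases (List.insertionSort (· ≥ ·) L)[r]? <;> simp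
  refine ⟨h1, fun r => ?_⟩
  unfold conj
  congr 1
  ext i
  simp only [Set.mem_setOf_eq, h1]
  omega
end
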